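/- arXiv:2509.10294 — 5 statements merged into one kernel-verified Lean document; each statement's English description precedes it below -/
import Mathlib

section
/- Let 𝒫₂ be a finite poset with a unique maximal element and k ≥ 2 an integer. For all positive integers n and m with n ≥ 2m + 1, every pair (ℐ, 𝒥) ∈ 𝓛*([n], m) satisfies |ℐ ∪ 𝒥| ≥ n − 2m; equivalently, f(n,m) ≥ n − 2m. -/
open Finset

/-- A family `F` of subsets of `[n]` (as subsets of `Fin n`) contains an induced copy of
the finite poset `P`: there is an injection `f : P → F` with `a ≤ b ↔ f a ⊆ f b`. -/
def ContainsCopy (P : Type) [PartialOrder P] {n : ℕ}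
    (F : Set (Finset (Fin n))) : Prop :=
  ∃ f : P → Finset (Fin n), Function.Injective f ∧ (∀ a, f a ∈ F) ∧
    ∀ a b : P, a ≤ b ↔ f a ⊆ f b

/-- `F` is `P`-saturated: it contains no induced copy of `P`, but adding any new set
creates one. -/
def IsSaturated (P : Type) [PartialOrder P] {n : ℕ}
    (F : Finset (Finset (Fin n))) : Prop :=
  ¬ ContainsCopy P (↑F : Set (Finset (Fin n))) ∧
    ∀ S : Finset (Fin n), S ∉ F →
      ContainsCopy P (insert S (↑F : Set (Finset (Fin n))))

/-- The induced saturation number `sat*(n, P)`. -/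
noncomputable def satStar (n : ℕ) (P : Type) [PartialOrder P] : ℕ :=
  sInf {m | ∃ F : Finset (Finset (Fin n)), IsSaturated P F ∧ F.card = m}

/-- The antichain poset `𝒜_k` with `k` elements. -/
def AC (k : ℕ) : Type := Fin k

instance (k : ℕ) : PartialOrder (AC k) where
  le a b := a = b
  le_refl _ := rfl
  le_trans _ _ _ h₁ h₂ := Eq.trans h₁ h₂
  le_antisymm _ _ h _ := h

instance (k : ℕ) : Fintype (AC k) := inferInstanceAs (Fintype (Fin k))

/-- Sets `X` such that some `𝒮 ⊆ I` makes `𝒮 ∪ {X}` an induced copy of `•*𝒜_k*P₂`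
with `X` as its (unique) maximal element. -/
def Lzero (P₂ : Type) [PartialOrder P₂] (k : ℕ) {n : ℕ}
    (I : Set (Finset (Fin n))) : Set (Finset (Fin n)) :=
  {X | ∃ f : (P₂ ⊕ₗ (AC k ⊕ₗ Unit)) → Finset (Fin n),
      Function.Injective f ∧ (∀ a b, a ≤ b ↔ f a ⊆ f b) ∧
      f (toLex (Sum.inr (toLex (Sum.inr Unit.unit)))) = X ∧
      ∀ a, a ≠ toLex (Sum.inr (toLex (Sum.inr Unit.unit))) → f a ∈ I}

/-- `𝒯₀(ℐ,𝒥)`: sets `A` containing no member of `𝒥` such that some `𝒮 ⊆ ℐ` makes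
`𝒮 ∪ {A}` an induced copy of `•*𝒜_k*P₂` with `A` as its maximal element. -/
def Tzero (P₂ : Type) [PartialOrder P₂] (k : ℕ) {n : ℕ}
    (I J : Set (Finset (Fin n))) : Set (Finset (Fin n)) :=
  {A ∈ Lzero P₂ k I | ∀ B ∈ J, ¬ B ⊆ A}

/-- `𝒯(ℐ,𝒥)`: the minimal elements of `𝒯₀(ℐ,𝒥)`. -/
def Tfam (P₂ : Type) [PartialOrder P₂] (k : ℕ) {n : ℕ}
    (I J : Set (Finset (Fin n))) : Set (Finset (Fin n)) :=
  {A ∈ Tzero P₂ k I J | ∀ B ∈ Tzero P₂ k I J, B ⊆ A → B = A}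

/-- `(𝒢,ℋ) ∈ 𝓛([n], m)`. -/
def LLmem (n m : ℕ) (G H : Set (Finset (Fin n))) : Prop :=
  Disjoint G H ∧
  (∀ A ∈ G, A.card ≤ m) ∧
  (∀ A ∈ H, n - m ≤ A.card) ∧
  (∀ i : Fin n, ∃ A ∈ G, i ∈ A) ∧
  (∀ A ∈ G ∪ H, ∀ B ∈ G ∪ H, A ⊂ B → A ∈ H ∧ B ∈ H) ∧
  (∀ A : Finset (Fin n), m ≤ A.card → A.card ≤ n - m → ∃ B ∈ G ∪ H, B ⊆ A ∨ A ⊆ B)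

/-- `(ℐ,𝒥) ∈ 𝓛*([n], m)`. -/
def LLstarMem (P₂ : Type) [PartialOrder P₂] (k n m : ℕ)
    (I J : Set (Finset (Fin n))) : Prop :=
  LLmem n m (Tfam P₂ k I J) J ∧ ∀ A ∈ I, A.card ≤ m

/-- If a family of finite sets has more than `d` fewer members than the ground set has points,
then there is a set `X` of points such that the members meeting `X` have distinct representatives
in `X`, with more than `d` points of `X` unused. -/
theorem exists_distinct_representatives_of_card_add_lt {ι α : Type*} [Fintype ι] [Fintype α]
    [DecidableEq α] (s : ι → Finset α) (d : ℕ) (h : Fintype.card ι + d < Fintype.card α) :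
    ∃ X : Finset α, #{b | (s b ∩ X).Nonempty} + d < #X ∧
      ∃ f : {b // (s b ∩ X).Nonempty} → α, Function.Injective f ∧ ∀ b, f b ∈ s b.1 ∩ X := by
  classical
  obtain ⟨X, hX, hmin⟩ := exists_min_image
    ({X | #{b | (s b ∩ X).Nonempty} + d < #X} : Finset (Finset α)) card
    ⟨univ, by
      have := card_le_univ ({b | (s b ∩ univ).Nonempty} : Finset ι)
      simp only [mem_filter, mem_univ, true_and, card_univ]
      omega⟩
  simp only [mem_filter, mem_univ, true_and] at hX hmin
  refine ⟨X, hX, (all_card_le_biUnion_card_iff_exists_injective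
    (fun b : {b // (s b ∩ X).Nonempty} ↦ s b.1 ∩ X)).1 fun S ↦ ?_⟩
  by_contra! hlt
  set Z := S.biUnion fun b ↦ s b.1 ∩ X with hZ
  have hZX : Z ⊆ X := by
    rw [hZ, biUnion_subset]
    exact fun b _ ↦ inter_subset_right
  have hZne : 0 < #Z := by
    obtain ⟨b, hb⟩ := card_pos.1 (Nat.zero_lt_of_lt hlt)
    obtain ⟨x, hx⟩ := b.2
    exact card_pos.2 ⟨x, mem_biUnion.2 ⟨b, hb, hx⟩⟩
  have hcard : #(X \ Z) = #X - #Z := card_sdiff_of_subset hZX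
  have hle := card_le_card hZX
  have hsub : ({b | (s b ∩ (X \ Z)).Nonempty} : Finset ι) ⊆
      ({b | (s b ∩ X).Nonempty} : Finset ι) \ S.map (Function.Embedding.subtype _) := by
    intro b hb
    obtain ⟨x, hx⟩ := (mem_filter.1 hb).2
    simp only [mem_inter, mem_sdiff] at hx
    have hbX : (s b ∩ X).Nonempty := ⟨x, mem_inter.2 ⟨hx.1, hx.2.1⟩⟩
    refine mem_sdiff.2 ⟨mem_filter.2 ⟨mem_univ _, hbX⟩, fun hbS ↦ hx.2.2 ?_⟩
    obtain ⟨c, hc, rfl⟩ := mem_map.1 hbS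
    exact mem_biUnion.2 ⟨c, hc, mem_inter.2 ⟨hx.1, hx.2.1⟩⟩
  have hSN : S.map (Function.Embedding.subtype _) ⊆
      ({b | (s b ∩ X).Nonempty} : Finset ι) := by
    intro b hb
    obtain ⟨c, -, rfl⟩ := mem_map.1 hb
    exact mem_filter.2 ⟨mem_univ _, c.2⟩
  have h₁ := card_le_card hsub
  have h₂ := card_le_card hSN
  rw [card_sdiff_of_subset hSN] at h₁
  rw [card_map] at h₁ h₂
  have := hmin (X \ Z) (by omega)
  omega

/-- The union of the antichain in a copy of `•*𝒜_k*P₂` with top `A` is again the top of such a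
copy. -/
theorem exists_subset_mem_Lzero {P₂ : Type} [PartialOrder P₂] {k n : ℕ} (hk : 2 ≤ k)
    {I : Set (Finset (Fin n))} {A : Finset (Fin n)} (hA : A ∈ Lzero P₂ k I) :
    ∃ U ∈ Lzero P₂ k I, U ⊆ A ∧ ∀ x ∈ U, ∃ S ∈ I, x ∈ S ∧ S ⊆ U := by
  classical
  obtain ⟨f, -, hf, rfl, hI⟩ := hA
  set t : P₂ ⊕ₗ (AC k ⊕ₗ Unit) := toLex (Sum.inr (toLex (Sum.inr Unit.unit))) with ht
  let e : AC k → P₂ ⊕ₗ (AC k ⊕ₗ Unit) := fun i ↦ toLex (Sum.inr (toLex (Sum.inl i)))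
  have he : ∀ i, e i ≠ t := fun i h ↦ by simp [e, t] at h
  have hle : ∀ a, a ≤ t := by
    rintro (p | i | u)
    · exact Sum.Lex.inl_le_inr _ _
    · exact Sum.Lex.inr_le_inr_iff.2 (Sum.Lex.inl_le_inr _ _)
    · exact le_rfl
  have hemem : ∀ i, f (e i) ⊆ univ.biUnion fun i ↦ f (e i) := fun i ↦
    subset_biUnion_of_mem (fun i ↦ f (e i)) (mem_univ i)
  have hlow : ∀ a, a ≠ t → (∃ i, a ≤ e i) ∧ ∃ i, ¬ e i ≤ a := by
    let i₀ : AC k := (⟨0, by omega⟩ : Fin k)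
    let i₁ : AC k := (⟨1, by omega⟩ : Fin k)
    have hi : i₀ ≠ i₁ := fun h ↦ by simpa using congrArg Fin.val h
    rintro (p | i | u) ha
    · exact ⟨⟨i₀, Sum.Lex.inl_le_inr _ _⟩, i₀, Sum.Lex.not_inr_le_inl⟩
    · refine ⟨⟨i, le_rfl⟩, ?_⟩
      have key : ∀ j, e j ≤ e i → j = i := fun j h ↦
        Sum.Lex.inl_le_inl_iff.1 (Sum.Lex.inr_le_inr_iff.1 h)
      by_contra! hall
      exact hi ((key _ (hall i₀)).trans (key _ (hall i₁)).symm)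
    · exact absurd rfl ha
  set U := univ.biUnion fun i ↦ f (e i) with hU
  have hsub : ∀ a, a ≠ t → f a ⊆ U := fun a ha ↦
    let ⟨i, hi⟩ := (hlow a ha).1
    ((hf _ _).1 hi).trans (hemem i)
  have hnot : ∀ a, a ≠ t → ¬ U ⊆ f a := fun a ha h ↦
    let ⟨i, hi⟩ := (hlow a ha).2
    hi ((hf _ _).2 ((hemem i).trans h))
  have hiff : ∀ a b, a ≤ b ↔ Function.update f t U a ⊆ Function.update f t U b := by
    intro a b
    by_cases ha : a = t <;> by_cases hb : b = t
    · simp [ha, hb]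
    · rw [ha, Function.update_self, Function.update_of_ne hb]
      exact iff_of_false (fun h ↦ hb ((hle b).antisymm h)) (hnot b hb)
    · rw [hb, Function.update_self, Function.update_of_ne ha]
      exact iff_of_true (hle a) (hsub a ha)
    · rw [Function.update_of_ne ha, Function.update_of_ne hb]
      exact hf a b
  refine ⟨U, ⟨Function.update f t U, fun a b hab ↦ ?_, hiff, Function.update_self .., ?_⟩, ?_, ?_⟩
  · exact ((hiff a b).2 hab.subset).antisymm ((hiff b a).2 hab.superset)
  · intro a ha
    rw [Function.update_of_ne ha]
    exact hI a ha
  · rw [hU, biUnion_subset]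
    exact fun i _ ↦ (hf _ _).1 (hle _)
  · intro x hx
    obtain ⟨i, -, hi⟩ := mem_biUnion.1 hx
    exact ⟨f (e i), hI _ (he i), hi, hemem i⟩

/-- Every member of `𝒯(ℐ,𝒥)` is a union of members of `ℐ`. -/
theorem exists_mem_subset_of_mem_Tfam {P₂ : Type} [PartialOrder P₂] {k n : ℕ} (hk : 2 ≤ k)
    {I J : Set (Finset (Fin n))} {A : Finset (Fin n)} (hA : A ∈ Tfam P₂ k I J) :
    ∀ x ∈ A, ∃ S ∈ I, x ∈ S ∧ S ⊆ A := by
  obtain ⟨U, hU, hUA, hcov⟩ := exists_subset_mem_Lzero hk hA.1.1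
  obtain rfl := hA.2 U ⟨hU, fun B hB h ↦ hA.1.2 B hB (h.trans hUA)⟩ hUA
  exact hcov

/-- If `(G, J) ∈ 𝓛([n], m)` and every member of `G` is a union of members of `I`, all of size at
most `m`, then `|I ∪ J| ≥ n - 2m`. -/
theorem LLmem.le_ncard_union {n m : ℕ} (hn : 2 * m + 1 ≤ n) {G I J : Set (Finset (Fin n))}
    (h : LLmem n m G J) (hI : ∀ A ∈ I, #A ≤ m)
    (hGI : ∀ A ∈ G, ∀ x ∈ A, ∃ S ∈ I, x ∈ S ∧ S ⊆ A) :
    n - 2 * m ≤ (I ∪ J).ncard := by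
  classical
  obtain ⟨hdisj, hG, hJ, hcov, hcomp, hmid⟩ := h
  have hanti : ∀ A ∈ G, ∀ B ∈ G ∪ J, A ⊆ B → A = B := fun A hA B hB hAB ↦ by
    by_contra hne
    exact Set.disjoint_left.1 hdisj hA (hcomp A (.inl hA) B hB (hAB.ssubset_of_ne hne)).1
  by_contra! hlt
  have hcardι : Fintype.card ↥(I ∪ J) = (I ∪ J).ncard := by
    rw [← Nat.card_eq_fintype_card, Nat.card_coe_set_eq]
  obtain ⟨s, hs⟩ : ∃ s : ↥(I ∪ J) → Finset (Fin n), ∀ b, s b = if b.1 ∈ J then b.1ᶜ else b.1 :=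
    ⟨_, fun _ ↦ rfl⟩
  obtain ⟨X, hX, f, hf, hfX⟩ := exists_distinct_representatives_of_card_add_lt s (2 * m)
    (by rw [hcardι, Fintype.card_fin]; omega)
  set R := univ.image f
  have hRcard : #R ≤ #{b | (s b ∩ X).Nonempty} := by
    refine card_image_le.trans_eq ?_
    rw [card_univ, Fintype.card_subtype]
  have hfree : 2 * m ≤ #(X \ R) := by
    have := le_card_sdiff R X
    omega
  obtain ⟨M, hM, hMcard⟩ := exists_subset_card_eq (show m ≤ #(X \ R) by omega)
  have hrest : m ≤ #((X \ R) \ M) := by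
    rw [card_sdiff_of_subset hM]
    omega
  obtain ⟨x₀, hx₀⟩ : X.Nonempty := card_pos.1 (by omega)
  obtain ⟨G₀, hG₀, hxG₀⟩ := hcov x₀
  set A := (G₀ \ X) ∪ (({b | b.1.1 ∈ J} : Finset {b // (s b ∩ X).Nonempty}).image f ∪ M) with hA
  have hAX : ∀ x ∈ A, x ∉ X → x ∈ G₀ := by
    intro x hx hxX
    simp only [hA, mem_union, mem_sdiff, mem_image] at hx
    rcases hx with hx | ⟨b, -, rfl⟩ | hx
    · exact hx.1
    · exact absurd (mem_inter.1 (hfX b)).2 hxX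
    · exact absurd (mem_sdiff.1 (hM hx)).1 hxX
  have hGA : ∀ B ∈ G, ¬ B ⊆ A := by
    intro B hB hBA
    by_cases hBX : ∃ x ∈ B, x ∈ X
    · obtain ⟨x, hxB, hxX⟩ := hBX
      obtain ⟨S, hS, hxS, hSB⟩ := hGI B hB x hxB
      have hSJ : S ∉ J := fun hSJ ↦ by
        have := hI S hS
        have := hJ S hSJ
        omega
      have hsS : s ⟨S, .inl hS⟩ = S := (hs _).trans (if_neg hSJ)
      let b : {b // (s b ∩ X).Nonempty} :=
        ⟨⟨S, .inl hS⟩, x, mem_inter.2 ⟨by rwa [hsS], hxX⟩⟩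
      have hb := mem_inter.1 (hfX b)
      have hbS : f b ∈ S := hsS ▸ hb.1
      have hbA := hBA (hSB hbS)
      simp only [hA, mem_union, mem_sdiff, mem_image, mem_filter, mem_univ, true_and] at hbA
      rcases hbA with h | ⟨c, hc, hcb⟩ | h
      · exact h.2 hb.2
      · rw [hf hcb] at hc
        exact hSJ hc
      · exact (mem_sdiff.1 (hM h)).2 (mem_image_of_mem f (mem_univ b))
    · push Not at hBX
      have := hanti B hB G₀ (.inl hG₀) fun x hx ↦ hAX x (hBA hx) (hBX x hx)
      exact hBX x₀ (this ▸ hxG₀) hx₀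
  have hAJ : ∀ B ∈ J, ¬ A ⊆ B := by
    intro B hB hAB
    have hsB : s ⟨B, .inr hB⟩ = Bᶜ := (hs _).trans (if_pos hB)
    by_cases hBX : (s ⟨B, .inr hB⟩ ∩ X).Nonempty
    · have hb := (mem_inter.1 (hfX ⟨⟨B, .inr hB⟩, hBX⟩)).1
      have hb' : f ⟨⟨B, .inr hB⟩, hBX⟩ ∈ Bᶜ := hsB ▸ hb
      refine mem_compl.1 hb' (hAB (mem_union_right _ (mem_union_left _ ?_)))
      exact mem_image_of_mem f (mem_filter.2 ⟨mem_univ _, hB⟩)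
    · have hXB : X ⊆ B := fun x hx ↦ by
        by_contra hxB
        exact hBX ⟨x, mem_inter.2 ⟨hsB ▸ mem_compl.2 hxB, hx⟩⟩
      have hG₀B : G₀ ⊆ B := fun x hx ↦ by
        by_cases hxX : x ∈ X
        · exact hXB hxX
        · exact hAB (mem_union_left _ (mem_sdiff.2 ⟨hx, hxX⟩))
      exact Set.disjoint_left.1 hdisj hG₀ (hanti G₀ hG₀ B (.inr hB) hG₀B ▸ hB)
  have hmA : m ≤ #A :=
    hMcard ▸ card_le_card (subset_union_right.trans subset_union_right)
  have hAm : #A ≤ n - m := by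
    have hd : Disjoint A ((X \ R) \ M) := by
      rw [disjoint_right]
      intro x hx hxA
      simp only [mem_sdiff] at hx
      simp only [hA, mem_union, mem_sdiff, mem_image] at hxA
      rcases hxA with h | ⟨b, -, rfl⟩ | h
      · exact h.2 hx.1.1
      · exact hx.1.2 (mem_image_of_mem f (mem_univ b))
      · exact hx.2 h
    have := card_le_univ (A ∪ ((X \ R) \ M))
    rw [card_union_of_disjoint hd, Fintype.card_fin] at this
    omega
  obtain ⟨B, hB | hB, hBA | hAB⟩ := hmid A hmA hAm
  · exact hGA B hB hBA
  · exact hGA B hB (eq_of_subset_of_card_le hAB ((hG B hB).trans hmA)).superset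
  · exact hAJ B hB (eq_of_subset_of_card_le hBA (hAm.trans (hJ B hB))).superset
  · exact hAJ B hB hAB

/-- Lemma 6 of the diamond paper, adapted: every
`(ℐ,𝒥) ∈ 𝓛*([n],m)` satisfies `|ℐ ∪ 𝒥| ≥ n - 2m`; equivalently `f(n,m) ≥ n - 2m`. -/
theorem statement13 (P₂ : Type) [PartialOrder P₂] [Fintype P₂]
    (hP₂ : ∃! a : P₂, IsMax a) (k : ℕ) (hk : 2 ≤ k)
    (n m : ℕ) (hm : 1 ≤ m) (hn : 2 * m + 1 ≤ n)
    (I J : Set (Finset (Fin n))) (hIJ : LLstarMem P₂ k n m I J) :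
    n - 2 * m ≤ (I ∪ J).ncard := by
  exact hIJ.1.le_ncard_union hn hIJ.2 fun _ hA ↦ exists_mem_subset_of_mem_Tfam hk hA
end

section
/- Let n ≥ 1, let k ≥ 2 be an integer, let 𝒫₁ be a finite poset with a unique minimal element, and let 𝒫₂ be a finite poset with a unique maximal element. If ℱ is a 𝒫₁*𝒜_k*𝒫₂-saturated family of subsets of [n], then |ℱ| ≥ (n+1)/9. -/
open Finset

/-- If there are more points than sets plus one, some nonempty `U` carries a subset `R` such that
every member of the family meeting `U` leaves `R` inside `U`, every member not containing `U`
misses a point of `R`, and no point of `U` is the difference of two nested members. -/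
theorem exists_transversal_subset {n : ℕ} (F : Finset (Finset (Fin n))) (h : F.card + 1 < n) :
    ∃ U R : Finset (Fin n), U.Nonempty ∧ R ⊆ U ∧
      (∀ X ∈ F, (X ∩ U).Nonempty → ∃ a ∈ X ∩ U, a ∉ R) ∧
      (∀ X ∈ F, ¬ U ⊆ X → ∃ b ∈ R, b ∉ X) ∧
      (∀ X ∈ F, ∀ i ∈ U, i ∉ X → insert i X ∉ F) := by
  let L : (Fin n → ℚ) →ₗ[ℚ] (Option F → ℚ) :=
    LinearMap.pi fun o => ∑ x ∈ o.elim univ (fun X => X.1), LinearMap.proj x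
  have hker : LinearMap.ker L ≠ ⊥ := by
    apply LinearMap.ker_ne_bot_of_finrank_lt
    simpa using h
  obtain ⟨v, hv, hv0⟩ := (Submodule.ne_bot_iff _).1 hker
  have hL : ∀ o : Option F, ∑ x ∈ o.elim univ (fun X => X.1), v x = 0 := fun o => by
    have := congrFun (LinearMap.mem_ker.1 hv) o
    simpa [L] using this
  have hF : ∀ X ∈ F, ∑ x ∈ X, v x = 0 := fun X hX => hL (some ⟨X, hX⟩)
  have hcompl : ∀ X ∈ F, ∑ x ∈ Xᶜ, v x = 0 := fun X hX => by
    have h1 : ∑ x, v x = 0 := hL none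
    have h2 := Finset.sum_add_sum_compl X v
    rw [hF X hX, h1, zero_add] at h2
    exact h2
  refine ⟨univ.filter (fun x => v x ≠ 0), univ.filter (fun x => 0 < v x), ?_, ?_, ?_, ?_, ?_⟩
  · obtain ⟨i, hi⟩ := Function.ne_iff.1 hv0
    exact ⟨i, by simpa using hi⟩
  · intro x hx
    simp only [mem_filter, mem_univ, true_and] at hx ⊢
    exact hx.ne'
  · rintro X hX ⟨x, hx⟩
    simp only [mem_inter, mem_filter, mem_univ, true_and] at hx
    obtain ⟨a, ha, hneg⟩ : ∃ a ∈ X, v a < 0 := by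
      by_contra! hc
      exact hx.2 ((Finset.sum_eq_zero_iff_of_nonneg hc).1 (hF X hX) x hx.1)
    exact ⟨a, by simp [ha, hneg.ne], by simp [hneg.le]⟩
  · intro X hX hU
    obtain ⟨x, hx, hxX⟩ := Finset.not_subset.1 hU
    simp only [mem_filter, mem_univ, true_and] at hx
    obtain ⟨b, hb, hpos⟩ : ∃ b ∈ Xᶜ, 0 < v b := by
      by_contra! hc
      exact hx ((Finset.sum_eq_zero_iff_of_nonpos hc).1 (hcompl X hX) x (by simpa using hxX))
    exact ⟨b, by simpa using hpos, by simpa using hb⟩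
  · intro X hX i hi hiX hins
    have h1 := hF _ hins
    rw [Finset.sum_insert hiX, hF X hX, add_zero] at h1
    simp [h1] at hi

/-- A family without a `W ⊂ antichain ⊂ V` configuration between a low and a high member, in which
every new set creates such a configuration, has at least `n - 1` members. -/
theorem le_card_add_one_of_saturating {n : ℕ} {ι : Type} [Nontrivial ι]
    (F : Finset (Finset (Fin n))) (low high : Finset (Fin n) → Prop)
    (hlow : ∀ W, low W → W ∈ F)
    (hfree : ∀ (W V : Finset (Fin n)) (T : ι → Finset (Fin n)), low W → high V →
      (∀ j, T j ∈ F) → (∀ j l, T j ⊆ T l → j = l) → (∀ j, W ⊂ T j) → (∀ j, T j ⊂ V) → False)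
    (hsat : ∀ S, S ∉ F →
      (∃ (V : Finset (Fin n)) (T : ι → Finset (Fin n)), high V ∧ (∀ j, T j ∈ F) ∧
        (∀ j l, T j ⊆ T l → j = l) ∧ (∀ j, S ⊂ T j) ∧ (∀ j, T j ⊂ V)) ∨
      (∃ (W V : Finset (Fin n)) (T : ι → Finset (Fin n)) (j₀ : ι), low W ∧ high V ∧ T j₀ = S ∧
        (∀ j, j ≠ j₀ → T j ∈ F) ∧
        (∀ j l, T j ⊆ T l → j = l) ∧ (∀ j, W ⊂ T j) ∧ (∀ j, T j ⊂ V)) ∨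
      (∃ (W : Finset (Fin n)) (T : ι → Finset (Fin n)), low W ∧ (∀ j, T j ∈ F) ∧
        (∀ j l, T j ⊆ T l → j = l) ∧ (∀ j, W ⊂ T j) ∧ (∀ j, T j ⊂ S))) :
    n ≤ F.card + 1 := by
  classical
  by_contra! hn
  obtain ⟨U, R, ⟨i, hiU⟩, hRU, hmeet, hmiss, hins⟩ := exists_transversal_subset F hn
  -- Members of `F` below or above `M ∪ R`, for `M` disjoint from `U`, ignore the `R` part.
  have below : ∀ M, ∀ X ∈ F, X ⊆ (M \ U) ∪ R → X ⊆ M \ U := by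
    intro M X hX hsub
    have hdis : ¬ (X ∩ U).Nonempty := by
      intro hne
      obtain ⟨a, ha, haR⟩ := hmeet X hX hne
      simp only [mem_inter] at ha
      have := hsub ha.1
      simp only [mem_union, mem_sdiff] at this
      tauto
    intro x hx
    have hxU : x ∉ U := fun hxU => hdis ⟨x, mem_inter.2 ⟨hx, hxU⟩⟩
    have := hsub hx
    simp only [mem_union] at this
    exact this.resolve_right fun h => hxU (hRU h)
  have above : ∀ M, ∀ X ∈ F, (M \ U) ∪ R ⊆ X → M ∪ U ⊆ X := by
    intro M X hX hsub
    have hUX : U ⊆ X := by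
      by_contra hc
      obtain ⟨b, hb, hbX⟩ := hmiss X hX hc
      exact hbX (hsub (mem_union_right _ hb))
    intro x hx
    by_cases hxU : x ∈ U
    · exact hUX hxU
    · exact hsub (by simp only [mem_union, mem_sdiff] at hx ⊢; tauto)
  have new : ∀ M, (M \ U) ∪ R ∉ F := by
    intro M hM
    have h1 := below M _ hM subset_rfl
    have h2 := above M _ hM subset_rfl
    exact (mem_sdiff.1 (h1 (h2 (mem_union_right _ hiU)))).2 hiU
  have shrink : ∀ X, low X → ∃ W, low W ∧ W ⊆ X \ U := by
    intro X hX
    rcases hsat _ (new X) with ⟨V, T, hV, hTF, hT, hST, hTV⟩ | ⟨W, V, T, j₀, hW, -, hj, -, -, hWT, -⟩ |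
      ⟨W, T, hW, hTF, hT, hWT, hTS⟩
    · exfalso
      have hXT : ∀ j, X ⊆ T j := fun j =>
        subset_union_left.trans (above X _ (hTF j) (hST j).subset)
      refine hfree X V T hX hV hTF hT (fun j => (hXT j).ssubset_of_ne ?_) hTV
      rintro rfl
      obtain ⟨l, hl⟩ := exists_ne j
      exact hl (hT _ _ (hXT l)).symm
    · exact ⟨W, hW, below X W (hlow W hW) (hj ▸ (hWT j₀).subset)⟩
    · obtain ⟨j, -⟩ := exists_pair_ne ι
      exact ⟨W, hW, below X W (hlow W hW) ((hWT j).trans (hTS j)).subset⟩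
  have exists_low : ∃ W, low W := by
    rcases hsat _ (new univ) with ⟨V, T, -, hTF, hT, hST, -⟩ | ⟨W, V, T, j₀, hW, -⟩ | ⟨W, T, hW, -⟩
    · obtain ⟨j, l, hjl⟩ := exists_pair_ne ι
      refine absurd (hT j l ?_) hjl
      exact (subset_univ _).trans (subset_union_left.trans (above univ _ (hTF l) (hST l).subset))
    · exact ⟨W, hW⟩
    · exact ⟨W, hW⟩
  -- A suitable pair `Y ⊂ V` separated by `i`, with `Y` above a low member and `V` high.
  let good : Finset (Fin n) → Prop := fun Y =>
    Y ∈ F ∧ i ∉ Y ∧ (∃ W, low W ∧ W ⊆ Y) ∧ ∃ V, high V ∧ insert i Y ⊆ V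
  have not_below : ∀ Y, (∃ W, low W ∧ W ⊆ Y) → i ∉ Y → ∀ (V : Finset (Fin n))
      (T : ι → Finset (Fin n)), high V → (∀ j, T j ∈ F) → (∀ j l, T j ⊆ T l → j = l) →
      (∀ j, insert i Y ⊂ T j) → (∀ j, T j ⊂ V) → False := by
    rintro Y ⟨W, hW, hWY⟩ - V T hV hTF hT hST hTV
    exact hfree W V T hW hV hTF hT
      (fun j => (hWY.trans (subset_insert i Y)).trans_ssubset (hST j)) hTV
  have exists_good : ∃ Y, good Y := by
    obtain ⟨W, hW, hmin⟩ := exists_min_image (univ.filter low) card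
      (exists_low.imp fun W hW => by simpa using hW)
    simp only [mem_filter, mem_univ, true_and] at hW hmin
    have hiW : i ∉ W := by
      intro hi
      obtain ⟨W', hW', hsub⟩ := shrink W hW
      have hlt : W' ⊂ W := by
        refine (hsub.trans sdiff_subset).ssubset_of_ne ?_
        rintro rfl
        exact (mem_sdiff.1 (hsub hi)).2 hiU
      exact absurd (hmin W' hW') (not_le.2 (card_lt_card hlt))
    refine ⟨W, hlow W hW, hiW, ⟨W, hW, subset_rfl⟩, ?_⟩
    rcases hsat _ (hins W (hlow W hW) i hiU hiW) with ⟨V, T, hV, hTF, hT, hST, hTV⟩ |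
      ⟨_, V, T, j₀, -, hV, hj, -, -, -, hTV⟩ | ⟨W', T, hW', -, -, hWT, hTS⟩
    · exact (not_below W ⟨W, hW, subset_rfl⟩ hiW V T hV hTF hT hST hTV).elim
    · exact ⟨V, hV, hj ▸ (hTV j₀).subset⟩
    · obtain ⟨j, -⟩ := exists_pair_ne ι
      have h1 := card_lt_card (hWT j)
      have h2 := card_lt_card (hTS j)
      rw [card_insert_of_notMem hiW] at h2
      have h3 := hmin W' hW'
      omega
  obtain ⟨Y, hY, hmax⟩ := exists_max_image (univ.filter good) card
    (exists_good.imp fun Y hY => by simpa using hY)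
  simp only [mem_filter, mem_univ, true_and] at hY hmax
  obtain ⟨hYF, hiY, hlowY, V, hV, hYV⟩ := hY
  rcases hsat _ (hins Y hYF i hiU hiY) with ⟨V, T, hV, hTF, hT, hST, hTV⟩ |
    ⟨W, V', T, j₀, hW, hV', hj, hTF, hT, hWT, hTV⟩ | ⟨W, T, hW, hTF, hT, hWT, hTS⟩
  · exact not_below Y hlowY hiY V T hV hTF hT hST hTV
  · obtain ⟨W', hW', hsub⟩ := shrink W hW
    have hW'W : W' ⊆ W := hsub.trans sdiff_subset
    have hiW' : i ∉ W' := fun h => (mem_sdiff.1 (hsub h)).2 hiU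
    have hW'Y : W' ⊆ Y := by
      have h1 := hW'W.trans (hWT j₀).subset
      rw [hj] at h1
      exact (subset_insert_iff_of_notMem hiW').1 h1
    have hnot : ∀ j, j ≠ j₀ → ¬ T j ⊆ Y := fun j hne hsub =>
      hne (hT j j₀ (hj ▸ hsub.trans (subset_insert i Y)))
    have hnot' : ∀ j, j ≠ j₀ → ¬ Y ⊆ T j := by
      intro j hne hsub
      have hiT : i ∉ T j := fun hi =>
        hne (hT j₀ j (hj ▸ insert_subset hi hsub)).symm
      have hgood : good (T j) := by
        refine ⟨hTF j hne, hiT, ?_, V', hV', ?_⟩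
        · exact hlowY.imp fun W h => ⟨h.1, h.2.trans hsub⟩
        · have hiV : i ∈ V' := (hTV j₀).subset (hj ▸ mem_insert_self i Y)
          exact insert_subset hiV (hTV j).subset
      have := hmax _ hgood
      exact absurd this (not_le.2 (card_lt_card (hsub.ssubset_of_ne fun h => hnot j hne h.ge)))
    refine hfree W' V' (Function.update T j₀ Y) hW' hV' ?_ ?_ ?_ ?_
    · intro j
      by_cases h : j = j₀
      · subst h; simpa using hYF
      · simpa [h] using hTF j h
    · intro j l hsub
      by_cases h : j = j₀ <;> by_cases h' : l = j₀
      · exact h.trans h'.symm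
      · subst h
        simp only [Function.update_self, Function.update_of_ne h'] at hsub
        exact (hnot' l h' hsub).elim
      · subst h'
        simp only [Function.update_self, Function.update_of_ne h] at hsub
        exact (hnot j h hsub).elim
      · simp only [Function.update_of_ne h, Function.update_of_ne h'] at hsub
        exact hT _ _ hsub
    · intro j
      by_cases h : j = j₀
      · subst h
        simp only [Function.update_self]
        refine hW'Y.ssubset_of_ne ?_
        rintro rfl
        obtain ⟨l, hl⟩ := exists_ne j
        exact hnot' l hl (hW'W.trans (hWT l).subset)
      · simpa [h] using hW'W.trans_ssubset (hWT j)
    · intro j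
      by_cases h : j = j₀
      · subst h
        simp only [Function.update_self]
        exact (subset_insert i Y).trans_ssubset (hj ▸ hTV j)
      · simpa [h] using hTV j
  · exact hfree W V T hW hV hTF hT hWT fun j => (hTS j).trans_subset hYV

theorem exists_forall_le_of_existsUnique_isMin {P : Type} [PartialOrder P] [Finite P]
    (h : ∃! a : P, IsMin a) : ∃ a : P, ∀ p, a ≤ p := by
  obtain ⟨a, -, ha⟩ := h
  refine ⟨a, fun p => ?_⟩
  obtain ⟨q, hqp, hq⟩ :=
    Set.IsPWO.exists_le_minimal (Set.toFinite (Set.univ : Set P)).isPWO (Set.mem_univ p)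
  have : q = a := ha q fun r hr => hq.2 (Set.mem_univ r) hr
  exact this ▸ hqp

/-- Copies of `P`, `Q` and `R` stacked on top of each other form a copy of the linear sum. -/
theorem ContainsCopy.of_stack {n : ℕ} {P Q R : Type} [PartialOrder P] [PartialOrder Q]
    [PartialOrder R] [Nonempty Q] {F : Set (Finset (Fin n))} (g : P → Finset (Fin n))
    (T : Q → Finset (Fin n)) (h : R → Finset (Fin n))
    (hgF : ∀ p, g p ∈ F) (hTF : ∀ j, T j ∈ F) (hhF : ∀ r, h r ∈ F)
    (hg : ∀ p q, p ≤ q ↔ g p ⊆ g q) (hT : ∀ j l, j ≤ l ↔ T j ⊆ T l)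
    (hh : ∀ r s, r ≤ s ↔ h r ⊆ h s) (hgT : ∀ p j, g p ⊂ T j) (hTh : ∀ j r, T j ⊂ h r) :
    ContainsCopy (P ⊕ₗ (Q ⊕ₗ R)) F := by
  have hgh : ∀ p r, g p ⊂ h r := fun p r =>
    (hgT p (Classical.arbitrary Q)).trans (hTh _ r)
  let f : P ⊕ₗ (Q ⊕ₗ R) → Finset (Fin n) := fun x =>
    Sum.elim g (fun y => Sum.elim T h (ofLex y)) (ofLex x)
  have hf : ∀ x y, x ≤ y ↔ f x ⊆ f y := by
    rintro (p | (j | r)) (q | (l | s))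
    · exact Sum.Lex.inl_le_inl_iff.trans (hg p q)
    · exact iff_of_true (Sum.Lex.inl_le_inr _ _) (hgT p l).subset
    · exact iff_of_true (Sum.Lex.inl_le_inr _ _) (hgh p s).subset
    · exact iff_of_false Sum.Lex.not_inr_le_inl (hgT q j).not_subset
    · exact (Sum.Lex.inr_le_inr_iff.trans Sum.Lex.inl_le_inl_iff).trans (hT j l)
    · exact iff_of_true (Sum.Lex.inr_le_inr_iff.2 (Sum.Lex.inl_le_inr _ _)) (hTh j s).subset
    · exact iff_of_false Sum.Lex.not_inr_le_inl (hgh q r).not_subset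
    · exact iff_of_false (fun hle => Sum.Lex.not_inr_le_inl (Sum.Lex.inr_le_inr_iff.1 hle))
        (hTh l r).not_subset
    · exact (Sum.Lex.inr_le_inr_iff.trans Sum.Lex.inr_le_inr_iff).trans (hh r s)
  refine ⟨f, fun x y hxy => le_antisymm ((hf x y).2 hxy.subset) ((hf y x).2 hxy.symm.subset), ?_, hf⟩
  rintro (p | (j | r))
  · exact hgF p
  · exact hTF j
  · exact hhF r

/-- A copy of a linear sum splits into copies of its parts stacked on top of each other. -/
theorem exists_stack_of_embedding {n : ℕ} {P Q R : Type} [PartialOrder P] [PartialOrder Q]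
    [PartialOrder R] {f : P ⊕ₗ (Q ⊕ₗ R) → Finset (Fin n)} (hf : ∀ x y, x ≤ y ↔ f x ⊆ f y) :
    ∃ (g : P → Finset (Fin n)) (T : Q → Finset (Fin n)) (h : R → Finset (Fin n)),
      (∀ p, g p = f (toLex (Sum.inl p))) ∧
      (∀ j, T j = f (toLex (Sum.inr (toLex (Sum.inl j))))) ∧
      (∀ r, h r = f (toLex (Sum.inr (toLex (Sum.inr r))))) ∧
      (∀ p q, p ≤ q ↔ g p ⊆ g q) ∧ (∀ j l, j ≤ l ↔ T j ⊆ T l) ∧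
      (∀ r s, r ≤ s ↔ h r ⊆ h s) ∧ (∀ p j, g p ⊂ T j) ∧ (∀ j r, T j ⊂ h r) := by
  refine ⟨_, _, _, fun p => rfl, fun j => rfl, fun r => rfl, ?_, ?_, ?_, ?_, ?_⟩
  · exact fun p q => Sum.Lex.inl_le_inl_iff.symm.trans (hf _ _)
  · exact fun j l =>
      (Sum.Lex.inr_le_inr_iff.trans Sum.Lex.inl_le_inl_iff).symm.trans (hf _ _)
  · exact fun r s =>
      (Sum.Lex.inr_le_inr_iff.trans Sum.Lex.inr_le_inr_iff).symm.trans (hf _ _)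
  · exact fun p j => ⟨(hf _ _).1 (Sum.Lex.inl_le_inr _ _),
      fun hsub => Sum.Lex.not_inr_le_inl ((hf _ _).2 hsub)⟩
  · exact fun j r => ⟨(hf _ _).1 (Sum.Lex.inr_le_inr_iff.2 (Sum.Lex.inl_le_inr _ _)),
      fun hsub => Sum.Lex.not_inr_le_inl (Sum.Lex.inr_le_inr_iff.1 ((hf _ _).2 hsub))⟩

/-- main theorem: any `P₁*𝒜_k*P₂`-saturated family over `[n]`, where `P₁`
has a unique minimal element and `P₂` a unique maximal element, has size at least
`(n+1)/9`. -/
theorem statement14 {n : ℕ} (hn : 1 ≤ n) (P₁ P₂ : Type)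
    [PartialOrder P₁] [PartialOrder P₂] [Fintype P₁] [Fintype P₂]
    (k : ℕ) (hk : 2 ≤ k)
    (hP₁ : ∃! a : P₁, IsMin a) (hP₂ : ∃! a : P₂, IsMax a)
    (F : Finset (Finset (Fin n)))
    (hF : IsSaturated (P₂ ⊕ₗ (AC k ⊕ₗ P₁)) F) :
    ((n : ℝ) + 1) / 9 ≤ (F.card : ℝ) := by
  obtain ⟨t, ht⟩ := exists_forall_le_of_existsUnique_isMin hP₁
  obtain ⟨b, hb⟩ : ∃ b : P₂, ∀ p, p ≤ b :=
    exists_forall_le_of_existsUnique_isMin (P := P₂ᵒᵈ) hP₂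
  have : Nontrivial (AC k) := Fin.nontrivial_iff_two_le.2 hk
  let low : Finset (Fin n) → Prop := fun W => ∃ g : P₂ → Finset (Fin n),
    (∀ p, g p ∈ F) ∧ (∀ p q, p ≤ q ↔ g p ⊆ g q) ∧ g b = W
  let high : Finset (Fin n) → Prop := fun V => ∃ h : P₁ → Finset (Fin n),
    (∀ p, h p ∈ F) ∧ (∀ p q, p ≤ q ↔ h p ⊆ h q) ∧ h t = V
  have hcard : n ≤ F.card + 1 := by
    refine le_card_add_one_of_saturating (ι := AC k) F low high ?_ ?_ ?_
    · rintro W ⟨g, hgF, -, rfl⟩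
      exact hgF b
    · rintro W V T ⟨g, hgF, hg, rfl⟩ ⟨h, hhF, hh, rfl⟩ hTF hT hgT hTh
      exact hF.1 (ContainsCopy.of_stack g T h hgF hTF hhF hg
        (fun j l => ⟨fun hjl => (congrArg T hjl).subset, hT j l⟩) hh
        (fun p j => ((hg p b).1 (hb p)).trans_ssubset (hgT j))
        (fun j r => (hTh j).trans_subset ((hh t r).1 (ht r))))
    · intro S hS
      obtain ⟨f, hinj, hfF, hf⟩ := hF.2 S hS
      obtain ⟨x, rfl⟩ : ∃ x, f x = S := by
        by_contra! hne
        exact hF.1 ⟨f, hinj, fun x => (hfF x).resolve_left (hne x), hf⟩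
      have hmem : ∀ y, y ≠ x → f y ∈ F := fun y hyx =>
        (hfF y).resolve_left fun h => hyx (hinj h)
      obtain ⟨g, T, h, hgf, hTf, hhf, hg, hT, hh, hgT, hTh⟩ := exists_stack_of_embedding hf
      have hgF : (∀ p, x ≠ toLex (Sum.inl p)) → low (g b) := fun hx =>
        ⟨g, fun p => hgf p ▸ hmem _ (hx p).symm, hg, rfl⟩
      have hhF : (∀ r, x ≠ toLex (Sum.inr (toLex (Sum.inr r)))) → high (h t) := fun hx =>
        ⟨h, fun r => hhf r ▸ hmem _ (hx r).symm, hh, rfl⟩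
      have hTF : ∀ j, x ≠ toLex (Sum.inr (toLex (Sum.inl j))) → T j ∈ F := fun j hx =>
        hTf j ▸ hmem _ hx.symm
      have hanti : ∀ j l, T j ⊆ T l → j = l := fun j l => (hT j l).2
      rcases x with p | (j₀ | r)
      · refine Or.inl ⟨h t, T, hhF fun r => Sum.inl_ne_inr, fun j => hTF j Sum.inl_ne_inr,
          hanti, fun j => ?_, fun j => hTh j t⟩
        have := hgT p j
        rwa [hgf] at this
      · refine Or.inr (Or.inl ⟨g b, h t, T, j₀, hgF fun p => Sum.inr_ne_inl,
          hhF fun r hr => Sum.inl_ne_inr (Sum.inr_injective hr), hTf j₀,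
          fun j hj => hTF j fun hr => hj (Sum.inl_injective (Sum.inr_injective hr)).symm,
          hanti, hgT b, fun j => hTh j t⟩)
      · refine Or.inr (Or.inr ⟨g b, T, hgF fun p => Sum.inr_ne_inl,
          fun j => hTF j fun hr => Sum.inr_ne_inl (Sum.inr_injective hr),
          hanti, hgT b, fun j => ?_⟩)
        have := hTh j r
        rwa [hhf] at this
  have hpos : 1 ≤ F.card := by
    rw [Nat.one_le_iff_ne_zero, Ne, card_eq_zero]
    rintro rfl
    obtain ⟨f, hinj, hfF, -⟩ := hF.2 ∅ (notMem_empty _)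
    have hf : ∀ x, f x = ∅ := fun x => by simpa using hfF x
    exact Sum.inl_ne_inr (hinj ((hf (toLex (Sum.inl b))).trans
      (hf (toLex (Sum.inr (toLex (Sum.inr t))))).symm))
  have hcard' : (n : ℝ) ≤ F.card + 1 := by exact_mod_cast hcard
  have hpos' : (1 : ℝ) ≤ F.card := by exact_mod_cast hpos
  linarith
end

section
/- For any finite posets 𝒫₁ and 𝒫₂ and any integer k ≥ 2, sat*(n, 𝒫₁*𝒜_k*𝒫₂) ≥ (n+1)/9 for every n ≥ 1. In particular, the induced saturation number of 𝒫₁*𝒜_k*𝒫₂ is at least linear in n. -/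
open Finset

section Saturation

variable {P Q : Type} [PartialOrder P] [PartialOrder Q] {k n : ℕ}

/-- Some induced copy of `P` in `F` consists of subsets of `S`. -/
def CopyBelow (P : Type) [PartialOrder P] (F : Set (Finset (Fin n))) (S : Finset (Fin n)) :
    Prop :=
  ∃ l : P → Finset (Fin n), (∀ a, l a ∈ F) ∧ (∀ a b, a ≤ b ↔ l a ⊆ l b) ∧ ∀ a, l a ⊆ S

/-- Some induced copy of `P` in `F` consists of supersets of `S`. -/
def CopyAbove (P : Type) [PartialOrder P] (F : Set (Finset (Fin n))) (S : Finset (Fin n)) :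
    Prop :=
  ∃ u : P → Finset (Fin n), (∀ a, u a ∈ F) ∧ (∀ a b, a ≤ b ↔ u a ⊆ u b) ∧ ∀ a, S ⊆ u a

theorem CopyBelow.mono {F : Set (Finset (Fin n))} {S T : Finset (Fin n)}
    (h : CopyBelow P F S) (hST : S ⊆ T) : CopyBelow P F T := by
  obtain ⟨l, h₁, h₂, h₃⟩ := h
  exact ⟨l, h₁, h₂, fun a => (h₃ a).trans hST⟩

theorem CopyAbove.anti {F : Set (Finset (Fin n))} {S T : Finset (Fin n)}
    (h : CopyAbove P F T) (hST : S ⊆ T) : CopyAbove P F S := by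
  obtain ⟨u, h₁, h₂, h₃⟩ := h
  exact ⟨u, h₁, h₂, fun a => hST.trans (h₃ a)⟩

/-- A `k`-antichain lying between a copy of `P` and a copy of `Q` completes a copy of the
linear sum. -/
theorem containsCopy_of_antichain (hk : 2 ≤ k) {F : Set (Finset (Fin n))}
    {c : Fin k → Finset (Fin n)} (hcF : ∀ j, c j ∈ F) (hc : ∀ i j, c i ⊆ c j → i = j)
    (hP : CopyBelow P F (univ.inf c)) (hQ : CopyAbove Q F (univ.sup c)) :
    ContainsCopy (P ⊕ₗ (AC k ⊕ₗ Q)) F := by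
  obtain ⟨l, hlF, hl, hlc⟩ := hP
  obtain ⟨u, huF, hu, hcu⟩ := hQ
  have : Nontrivial (Fin k) := Fin.nontrivial_iff_two_le.2 hk
  have hlc' : ∀ a j, l a ⊆ c j := fun a j => (hlc a).trans (Finset.inf_le (mem_univ j))
  have hcu' : ∀ j b, c j ⊆ u b := fun j b =>
    (Finset.le_sup (f := c) (mem_univ j)).trans (hcu b)
  have hcl : ∀ a j, ¬ c j ⊆ l a := fun a j h => by
    obtain ⟨j', hj'⟩ := exists_ne j
    exact hj' (hc _ _ (h.trans (hlc' a j'))).symm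
  have huc : ∀ j b, ¬ u b ⊆ c j := fun j b h => by
    obtain ⟨j', hj'⟩ := exists_ne j
    exact hj' (hc _ _ ((hcu' j' b).trans h))
  let f : P ⊕ₗ (AC k ⊕ₗ Q) → Finset (Fin n) := fun x =>
    Sum.elim l (fun y => Sum.elim c u (ofLex y)) (ofLex x)
  have hf : ∀ a b, a ≤ b ↔ f a ⊆ f b := by
    intro x y
    rcases x with a | a | a <;> rcases y with b | b | b
    · exact Sum.Lex.inl_le_inl_iff.trans (hl a b)
    · exact iff_of_true (Sum.Lex.inl_le_inr _ _) (hlc' a b)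
    · exact iff_of_true (Sum.Lex.inl_le_inr _ _)
        ((hlc' a (Classical.arbitrary _)).trans (hcu' _ b))
    · exact iff_of_false Sum.Lex.not_inr_le_inl (hcl b a)
    · refine Sum.Lex.inr_le_inr_iff.trans (Sum.Lex.inl_le_inl_iff.trans ?_)
      exact ⟨fun h => by cases h; exact Subset.rfl, hc a b⟩
    · exact iff_of_true (Sum.Lex.inr_le_inr_iff.2 (Sum.Lex.inl_le_inr _ _)) (hcu' a b)
    · exact iff_of_false Sum.Lex.not_inr_le_inl fun h =>
        hcl b (Classical.arbitrary _) ((hcu' _ a).trans h)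
    · exact iff_of_false (fun h => Sum.Lex.not_inr_le_inl (Sum.Lex.inr_le_inr_iff.1 h)) (huc b a)
    · exact Sum.Lex.inr_le_inr_iff.trans (Sum.Lex.inr_le_inr_iff.trans (hu a b))
  refine ⟨f, fun a b h => le_antisymm ((hf a b).2 h.le) ((hf b a).2 h.ge), ?_, hf⟩
  rintro (a | a | a)
  exacts [hlF a, hcF a, huF a]

/-- In a copy of the linear sum created by adding `S`, the set `S` lies in the bottom part, in
the antichain, or in the top part. -/
theorem IsSaturated.cases_of_notMem {F : Finset (Finset (Fin n))}
    (hF : IsSaturated (P ⊕ₗ (AC k ⊕ₗ Q)) F) {S : Finset (Fin n)} (hS : S ∉ F) :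
    (∃ c : Fin k → Finset (Fin n), (∀ j, c j ∈ F) ∧ (∀ i j, c i ⊆ c j → i = j) ∧
      (∀ j, S ⊆ c j) ∧ CopyAbove Q F (univ.sup c)) ∨
    (∃ c : Fin k → Finset (Fin n), ∃ j₀, c j₀ = S ∧ (∀ j, j ≠ j₀ → c j ∈ F) ∧
      (∀ i j, c i ⊆ c j → i = j) ∧ CopyBelow P F (univ.inf c) ∧
      CopyAbove Q F (univ.sup c)) ∨
    (∃ c : Fin k → Finset (Fin n), (∀ j, c j ∈ F) ∧ (∀ i j, c i ⊆ c j → i = j) ∧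
      (∀ j, c j ⊆ S) ∧ CopyBelow P F (univ.inf c)) := by
  obtain ⟨f, hinj, hfF, hf⟩ := hF.2 S hS
  let pl : P → P ⊕ₗ (AC k ⊕ₗ Q) := fun a => toLex (Sum.inl a)
  let pc : Fin k → P ⊕ₗ (AC k ⊕ₗ Q) := fun j =>
    toLex (Sum.inr (toLex (Sum.inl (show AC k from j))))
  let pu : Q → P ⊕ₗ (AC k ⊕ₗ Q) := fun b => toLex (Sum.inr (toLex (Sum.inr b)))
  have hmem : ∀ x y, f y = S → x ≠ y → f x ∈ F := fun x y hy hxy =>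
    (hfF x).resolve_left fun h => hxy (hinj (h.trans hy.symm))
  have hl : ∀ a b, a ≤ b ↔ f (pl a) ⊆ f (pl b) := fun a b =>
    Sum.Lex.inl_le_inl_iff.symm.trans (hf _ _)
  have hu : ∀ a b, a ≤ b ↔ f (pu a) ⊆ f (pu b) := fun a b =>
    (Sum.Lex.inr_le_inr_iff.trans Sum.Lex.inr_le_inr_iff).symm.trans (hf _ _)
  have hc : ∀ i j, f (pc i) ⊆ f (pc j) → i = j := fun i j h =>
    Sum.Lex.inl_le_inl_iff.1 (Sum.Lex.inr_le_inr_iff.1 ((hf _ _).2 h))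
  have hlc : ∀ a j, f (pl a) ⊆ f (pc j) := fun a j => (hf _ _).1 (Sum.Lex.inl_le_inr _ _)
  have hcu : ∀ j b, f (pc j) ⊆ f (pu b) := fun j b =>
    (hf _ _).1 (Sum.Lex.inr_le_inr_iff.2 (Sum.Lex.inl_le_inr _ _))
  have hlow : (∀ a, f (pl a) ∈ F) → CopyBelow P F (univ.inf fun j => f (pc j)) := fun h =>
    ⟨fun a => f (pl a), h, hl, fun a => Finset.le_inf fun j _ => hlc a j⟩
  have hup : (∀ b, f (pu b) ∈ F) → CopyAbove Q F (univ.sup fun j => f (pc j)) := fun h =>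
    ⟨fun b => f (pu b), h, hu, fun b => Finset.sup_le fun j _ => hcu j b⟩
  have hne₁ : ∀ a j, pl a ≠ pc j := fun a j h => nomatch h
  have hne₂ : ∀ a b, pl a ≠ pu b := fun a b h => nomatch h
  have hne₃ : ∀ j b, pc j ≠ pu b := fun j b h => nomatch h
  by_cases h₁ : ∃ a, f (pl a) = S
  · obtain ⟨a, ha⟩ := h₁
    exact Or.inl ⟨fun j => f (pc j), fun j => hmem _ _ ha (hne₁ a j).symm, hc,
      fun j => ha ▸ hlc a j, hup fun b => hmem _ _ ha (hne₂ a b).symm⟩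
  by_cases h₂ : ∃ b, f (pu b) = S
  · obtain ⟨b, hb⟩ := h₂
    exact Or.inr (Or.inr ⟨fun j => f (pc j), fun j => hmem _ _ hb (hne₃ j b), hc,
      fun j => hb ▸ hcu j b, hlow fun a => hmem _ _ hb (hne₂ a b)⟩)
  by_cases h₃ : ∃ j, f (pc j) = S
  · obtain ⟨j₀, hj₀⟩ := h₃
    refine Or.inr (Or.inl ⟨fun j => f (pc j), j₀, hj₀, fun j hj => hmem _ _ hj₀ fun h => hj ?_,
      hc, hlow fun a => hmem _ _ hj₀ (hne₁ a j₀), hup fun b => hmem _ _ hj₀ (hne₃ j₀ b).symm⟩)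
    exact hc _ _ (congrArg f h).le
  · refine absurd ⟨f, hinj, ?_, hf⟩ hF.1
    rintro (a | a | a)
    · exact (hfF (pl a)).resolve_left fun h => h₁ ⟨a, h⟩
    · exact (hfF (pc a)).resolve_left fun h => h₃ ⟨a, h⟩
    · exact (hfF (pu a)).resolve_left fun h => h₂ ⟨a, h⟩

/-- If a weight vanishes on every member of a saturated family and on the ground set, then
whether a copy of `P` lies below `S` does not depend on the support of the weight. -/
theorem IsSaturated.copyBelow_filter (hk : 2 ≤ k) {F : Finset (Finset (Fin n))}
    (hF : IsSaturated (P ⊕ₗ (AC k ⊕ₗ Q)) F) {w : Fin n → ℝ}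
    (hpos : ∃ x, 0 < w x)
    (hw₁ : ∀ X ∈ F, (∀ x ∈ X, 0 ≤ w x) → ∀ x ∈ X, w x = 0)
    (hw₂ : ∀ X ∈ F, (∀ x, 0 < w x → x ∈ X) → ∀ x, w x ≠ 0 → x ∈ X)
    {S : Finset (Fin n)} (hS : CopyBelow P F S) : CopyBelow P F {x ∈ S | w x = 0} := by
  obtain ⟨p, hp⟩ := hpos
  set T : Finset (Fin n) := {x | 0 < w x ∨ w x = 0 ∧ x ∈ S} with hT
  have hTF : T ∉ F := fun h => hp.ne' <| hw₁ T h (by simp [hT]; grind) p (by simp [hT, hp])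
  have hlow : CopyBelow P F T → CopyBelow P F {x ∈ S | w x = 0} := by
    rintro ⟨l, hlF, hl, hlT⟩
    refine ⟨l, hlF, hl, fun a x hx => ?_⟩
    have h0 := hw₁ _ (hlF a) (fun y hy => by have := hlT a hy; simp [hT] at this; grind) x hx
    have := hlT a hx
    simp [hT] at this ⊢
    grind
  rcases hF.cases_of_notMem hTF with ⟨c, hcF, hc, hTc, hup⟩ | ⟨c, j₀, hj₀, -, -, h, -⟩ |
    ⟨c, hcF, hc, hcT, h⟩
  · refine absurd (containsCopy_of_antichain hk hcF hc (hS.mono ?_) hup) hF.1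
    refine Finset.le_inf fun j _ x hx => ?_
    by_cases hx0 : w x = 0
    · exact hTc j (by simp [hT, hx, hx0])
    · exact hw₂ _ (hcF j) (fun y hy => hTc j (by simp [hT, hy])) x hx0
  · exact hlow (h.mono (hj₀ ▸ Finset.inf_le (mem_univ j₀)))
  · exact hlow (h.mono ((Finset.inf_le (mem_univ ⟨0, by omega⟩)).trans (hcT _)))

/-- If a weight vanishes on every member of a saturated family and on the ground set, then
whether a copy of `Q` lies above `S` does not depend on the support of the weight. -/
theorem IsSaturated.copyAbove_union_filter (hk : 2 ≤ k) {F : Finset (Finset (Fin n))}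
    (hF : IsSaturated (P ⊕ₗ (AC k ⊕ₗ Q)) F) {w : Fin n → ℝ}
    (hpos : ∃ x, 0 < w x)
    (hw₁ : ∀ X ∈ F, (∀ x ∈ X, 0 ≤ w x) → ∀ x ∈ X, w x = 0)
    (hw₂ : ∀ X ∈ F, (∀ x, 0 < w x → x ∈ X) → ∀ x, w x ≠ 0 → x ∈ X)
    {S : Finset (Fin n)} (hS : CopyAbove Q F S) :
    CopyAbove Q F (S ∪ ({x | w x ≠ 0} : Finset (Fin n))) := by
  obtain ⟨p, hp⟩ := hpos
  set T : Finset (Fin n) := {x | 0 < w x ∨ w x = 0 ∧ x ∈ S} with hT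
  have hTF : T ∉ F := fun h => hp.ne' <| hw₁ T h (by simp [hT]; grind) p (by simp [hT, hp])
  have hup : CopyAbove Q F T → CopyAbove Q F (S ∪ ({x | w x ≠ 0} : Finset (Fin n))) := by
    rintro ⟨u, huF, hu, hTu⟩
    refine ⟨u, huF, hu, fun a x hx => ?_⟩
    by_cases hx0 : w x = 0
    · exact hTu a (by simp [hx0] at hx; simp [hT, hx, hx0])
    · exact hw₂ _ (huF a) (fun y hy => hTu a (by simp [hT, hy])) x hx0
  rcases hF.cases_of_notMem hTF with ⟨c, hcF, hc, hTc, h⟩ | ⟨c, j₀, hj₀, -, -, -, h⟩ |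
    ⟨c, hcF, hc, hcT, hlow⟩
  · exact hup (h.anti ((hTc ⟨0, by omega⟩).trans (Finset.le_sup (f := c) (mem_univ _))))
  · exact hup (h.anti (hj₀ ▸ Finset.le_sup (f := c) (mem_univ j₀)))
  · refine absurd (containsCopy_of_antichain hk hcF hc hlow (hS.anti ?_)) hF.1
    refine Finset.sup_le fun j _ x hx => ?_
    have h0 := hw₁ _ (hcF j) (fun y hy => by have := hcT j hy; simp [hT] at this; grind) x hx
    have := hcT j hx
    simp [hT, h0] at this
    exact this

/-- No nonzero weight vanishes on every member of a saturated family and on the ground set. -/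
theorem IsSaturated.weight_eq_zero (hk : 2 ≤ k) {F : Finset (Finset (Fin n))}
    (hF : IsSaturated (P ⊕ₗ (AC k ⊕ₗ Q)) F) {w : Fin n → ℝ}
    (hw : ∀ X ∈ F, ∑ x ∈ X, w x = 0) (hw' : ∑ x, w x = 0) : w = 0 := by
  by_contra hne
  have : Nontrivial (Fin k) := Fin.nontrivial_iff_two_le.2 hk
  have hpos : ∃ x, 0 < w x := by
    by_contra! h
    exact hne (funext fun x => (Finset.sum_eq_zero_iff_of_nonpos fun x _ => h x).1 hw' x
      (mem_univ x))
  have hw₁ : ∀ X ∈ F, (∀ x ∈ X, 0 ≤ w x) → ∀ x ∈ X, w x = 0 := fun X hX h =>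
    (Finset.sum_eq_zero_iff_of_nonneg h).1 (hw X hX)
  have hw₂ : ∀ X ∈ F, (∀ x, 0 < w x → x ∈ X) → ∀ x, w x ≠ 0 → x ∈ X := by
    intro X hX h x hx
    by_contra hxX
    have hsum : ∑ y ∈ Xᶜ, w y = 0 := by
      have := Finset.sum_add_sum_compl X w
      rw [hw X hX, hw', zero_add] at this
      exact this
    refine hx ((Finset.sum_eq_zero_iff_of_nonpos fun y hy => ?_).1 hsum x (by simpa using hxX))
    by_contra! hy'
    exact (mem_compl.1 hy) (h y hy')
  have hbelow := fun S => hF.copyBelow_filter (S := S) hk hpos hw₁ hw₂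
  have habove := fun S => hF.copyAbove_union_filter (S := S) hk hpos hw₁ hw₂
  obtain ⟨p, hp⟩ := hpos
  have hex : ∃ S, CopyBelow P (F : Set (Finset (Fin n))) S := by
    have hTF : ({x | 0 ≤ w x} : Finset (Fin n)) ∉ F := fun h =>
      hp.ne' <| hw₁ _ h (by simp) p (by simp [hp.le])
    rcases hF.cases_of_notMem hTF with ⟨c, hcF, hc, hTc, -⟩ | ⟨c, -, -, -, -, h, -⟩ |
      ⟨c, -, -, -, h⟩
    · obtain ⟨i, j, hij⟩ := exists_pair_ne (Fin k)
      refine absurd (hc i j fun x _ => ?_) hij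
      rcases le_or_gt 0 (w x) with hx | hx
      · exact hTc j (by simpa using hx)
      · exact hw₂ _ (hcF j) (fun y hy => hTc j (by simpa using hy.le)) x hx.ne
    · exact ⟨_, h⟩
    · exact ⟨_, h⟩
  obtain ⟨S₀, hS₀, hmin⟩ :=
    (Set.toFinite {S | CopyBelow P (F : Set (Finset (Fin n))) S}).exists_minimal hex
  have hS₀w : ∀ x ∈ S₀, w x = 0 := fun x hx =>
    (mem_filter.1 (hmin (hbelow _ hS₀) (filter_subset _ _) hx)).2
  -- A member of `F` between a copy of `P` and a copy of `Q` that misses part of the support.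
  have hstart : ∃ W ∈ F, CopyBelow P (F : Set (Finset (Fin n))) W ∧
      CopyAbove Q (F : Set (Finset (Fin n))) W ∧ ∃ i, w i ≠ 0 ∧ i ∉ W := by
    set T : Finset (Fin n) := S₀ ∪ ({x | 0 < w x} : Finset (Fin n)) with hT
    have hTw : ∀ x ∈ T, 0 ≤ w x := by
      intro x hx
      simp [hT] at hx
      rcases hx with hx | hx
      exacts [(hS₀w x hx).ge, hx.le]
    have hTS : ∀ x ∈ T, w x = 0 → x ∈ S₀ := by
      intro x hx hx0
      simpa [hT, hx0] using hx
    have hTF : T ∉ F := fun h => hp.ne' <| hw₁ T h hTw p (by simp [hT, hp])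
    rcases hF.cases_of_notMem hTF with ⟨c, hcF, hc, hTc, hup⟩ | ⟨c, j₀, hj₀, hcF, hc, hlow, hup⟩ |
      ⟨c, hcF, hc, hcT, hlow⟩
    · exact absurd (containsCopy_of_antichain hk hcF hc
        (hS₀.mono (Finset.le_inf fun j _ => subset_union_left.trans (hTc j))) hup) hF.1
    · obtain ⟨j, hj⟩ := exists_ne j₀
      have hcj : univ.inf c ⊆ c j := Finset.inf_le (mem_univ j)
      have hcj₀ : univ.inf c ⊆ T := hj₀ ▸ Finset.inf_le (mem_univ j₀)
      refine ⟨c j, hcF j hj, hlow.mono hcj, hup.anti (Finset.le_sup (f := c) (mem_univ j)), ?_⟩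
      by_contra! hsupp
      refine hj (hc j₀ j ?_).symm
      rw [hj₀]
      refine union_subset (fun x hx => ?_) (fun x hx => hsupp x (by simp at hx; exact hx.ne'))
      refine hcj (filter_subset (fun x => w x = 0) _ (hmin (hbelow _ hlow) (fun y hy => ?_) hx))
      exact hTS y (hcj₀ (mem_filter.1 hy).1) (mem_filter.1 hy).2
    · have hcS : ∀ j, c j ⊆ S₀ := fun j x hx =>
        hTS x (hcT j hx) (hw₁ _ (hcF j) (fun y hy => hTw y (hcT j hy)) x hx)
      obtain ⟨i, j, hij⟩ := exists_pair_ne (Fin k)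
      exact absurd (hc i j ((hcS i).trans
        (hmin (hlow.mono (Finset.inf_le (mem_univ j))) (hcS j)))) hij
  obtain ⟨W, hWF, hWl, hWu, i, hi, hiW⟩ := hstart
  obtain ⟨X, ⟨hXF, hXl, hXu, hiX⟩, hmax⟩ := (Set.toFinite {X | X ∈ F ∧
    CopyBelow P (F : Set (Finset (Fin n))) X ∧ CopyAbove Q (F : Set (Finset (Fin n))) X ∧
    i ∉ X}).exists_maximal ⟨W, hWF, hWl, hWu, hiW⟩
  have hXi : insert i X ∉ F := fun h => hi <| by
    have := hw _ h
    rwa [sum_insert hiX, hw _ hXF, add_zero] at this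
  have hXil : CopyBelow P (F : Set (Finset (Fin n))) (insert i X) := hXl.mono (subset_insert _ _)
  have hXiu : CopyAbove Q (F : Set (Finset (Fin n))) (insert i X) :=
    (habove _ hXu).anti (insert_subset (by simp [hi]) subset_union_left)
  rcases hF.cases_of_notMem hXi with ⟨c, hcF, hc, hTc, hup⟩ | ⟨c, j₀, hj₀, hcF, hc, hlow, hup⟩ |
      ⟨c, hcF, hc, hcT, hlow⟩
  · exact hF.1 (containsCopy_of_antichain hk hcF hc
      (hXil.mono (Finset.le_inf fun j _ => hTc j)) hup)
  · have hnX : ∀ j, j ≠ j₀ → ¬ X ⊆ c j := by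
      intro j hj hXc
      have hic : i ∉ c j := fun h => hj (hc j₀ j (hj₀ ▸ insert_subset h hXc)).symm
      have hcX : c j ⊆ X := hmax ⟨hcF j hj, hlow.mono (Finset.inf_le (mem_univ j)),
        hup.anti (Finset.le_sup (f := c) (mem_univ j)), hic⟩ hXc
      exact hj (hc j j₀ (hj₀ ▸ hcX.trans (subset_insert _ _)))
    have hcX : ∀ j, j ≠ j₀ → ¬ c j ⊆ X := fun j hj h =>
      hj (hc j j₀ (hj₀ ▸ h.trans (subset_insert _ _)))
    refine hF.1 (containsCopy_of_antichain hk (c := Function.update c j₀ X) (fun j => ?_)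
      (fun j j' => ?_) ((hbelow _ hlow).mono (Finset.le_inf fun j _ => ?_))
      (hup.anti (Finset.sup_le fun j _ => ?_)))
    · rcases eq_or_ne j j₀ with rfl | hj
      · simpa using hXF
      · simpa [hj] using hcF j hj
    · rcases eq_or_ne j j₀ with rfl | hj <;> rcases eq_or_ne j' j with rfl | hj'
      · simp
      · simpa [hj'] using fun h => absurd h (hnX j' hj')
      · simp
      · rcases eq_or_ne j' j₀ with rfl | hj''
        · simpa [hj] using fun h => absurd h (hcX j hj)
        · simpa [hj, hj''] using hc j j'
    · rcases eq_or_ne j j₀ with rfl | hj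
      · intro x hx
        rw [mem_filter] at hx
        have : x ∈ insert i X := hj₀ ▸ (Finset.inf_le (f := c) (mem_univ j)) hx.1
        rcases mem_insert.1 this with rfl | h
        · exact absurd hx.2 hi
        · simpa using h
      · simpa [hj] using (filter_subset _ _).trans (Finset.inf_le (f := c) (mem_univ j))
    · rcases eq_or_ne j j₀ with rfl | hj
      · simpa using (subset_insert i X).trans (hj₀ ▸ Finset.le_sup (f := c) (mem_univ j))
      · simpa [hj] using Finset.le_sup (f := c) (mem_univ j)
  · exact hF.1 (containsCopy_of_antichain hk hcF hc hlow
      (hXiu.anti (Finset.sup_le fun j _ => hcT j)))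

theorem IsSaturated.le_card_add_one (hk : 2 ≤ k) {F : Finset (Finset (Fin n))}
    (hF : IsSaturated (P ⊕ₗ (AC k ⊕ₗ Q)) F) : n ≤ F.card + 1 := by
  by_contra! hlt
  let φ : (Fin n → ℝ) →ₗ[ℝ] (Option F → ℝ) := LinearMap.pi fun o =>
    ∑ x ∈ o.elim univ Subtype.val, LinearMap.proj x
  have hker : LinearMap.ker φ ≠ ⊥ := LinearMap.ker_ne_bot_of_finrank_lt (by simpa using hlt)
  obtain ⟨w, hw, hw0⟩ := Submodule.exists_mem_ne_zero_of_ne_bot hker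
  have h := fun o => congrFun (LinearMap.mem_ker.1 hw) o
  refine hw0 (hF.weight_eq_zero hk (fun X hX => ?_) ?_)
  · simpa [φ] using h (some ⟨X, hX⟩)
  · simpa [φ] using h none

theorem IsSaturated.card_pos (hk : 2 ≤ k) {F : Finset (Finset (Fin n))}
    (hF : IsSaturated (P ⊕ₗ (AC k ⊕ₗ Q)) F) : 0 < F.card := by
  rw [Finset.card_pos, Finset.nonempty_iff_ne_empty]
  rintro rfl
  have : Nontrivial (Fin k) := Fin.nontrivial_iff_two_le.2 hk
  obtain ⟨i, j, hij⟩ := exists_pair_ne (Fin k)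
  rcases hF.cases_of_notMem (notMem_empty ∅) with ⟨c, hcF, -⟩ | ⟨c, j₀, -, hcF, -⟩ | ⟨c, hcF, -⟩
  · exact notMem_empty _ (hcF i)
  · obtain ⟨j, hj⟩ := exists_ne j₀
    exact notMem_empty _ (hcF j hj)
  · exact notMem_empty _ (hcF i)

theorem exists_isSaturated (P : Type) [PartialOrder P] [Nonempty P] (n : ℕ) :
    ∃ F : Finset (Finset (Fin n)), IsSaturated P F := by
  obtain ⟨F, hF, hmax⟩ := (Set.toFinite {F : Finset (Finset (Fin n)) |
    ¬ ContainsCopy P (F : Set (Finset (Fin n)))}).exists_maximal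
      ⟨∅, fun ⟨f, _, hf, _⟩ => by simpa using hf (Classical.arbitrary P)⟩
  refine ⟨F, hF, fun S hS => ?_⟩
  by_contra h
  rw [← coe_insert] at h
  exact hS (hmax h (subset_insert S F) (mem_insert_self S F))

end Saturation

/-- for any finite posets `P₁`, `P₂` and any `k ≥ 2`,
`sat*(n, P₁*𝒜_k*P₂) ≥ (n+1)/9` for every `n ≥ 1`. -/
theorem statement15 (P₁ P₂ : Type) [PartialOrder P₁] [PartialOrder P₂]
    [Fintype P₁] [Fintype P₂] (k : ℕ) (hk : 2 ≤ k)
    (n : ℕ) (hn : 1 ≤ n) :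
    ((n : ℝ) + 1) / 9 ≤ (satStar n (P₂ ⊕ₗ (AC k ⊕ₗ P₁)) : ℝ) := by
  have : Nonempty (P₂ ⊕ₗ (AC k ⊕ₗ P₁)) :=
    ⟨toLex (Sum.inr (toLex (Sum.inl (show AC k from ⟨0, by omega⟩))))⟩
  obtain ⟨F₀, hF₀⟩ := exists_isSaturated (P₂ ⊕ₗ (AC k ⊕ₗ P₁)) n
  obtain ⟨F, hF, hcard⟩ := Nat.sInf_mem
    (s := {m | ∃ F : Finset (Finset (Fin n)), IsSaturated (P₂ ⊕ₗ (AC k ⊕ₗ P₁)) F ∧ F.card = m})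
    ⟨_, F₀, hF₀, rfl⟩
  change F.card = satStar n _ at hcard
  rw [← hcard, div_le_iff₀ (by norm_num)]
  have h₁ := hF.le_card_add_one hk
  have h₂ := hF.card_pos hk
  exact_mod_cast (show n + 1 ≤ F.card * 9 by omega)
end

section
/- Let ℱ be any 𝒫_l*⋯*𝒫_1-saturated family of subsets of [n] containing ℱ_b ∪ ℱ_t, let i ∈ [l] with 𝒫_i an antichain, and let T ⊆ [m] satisfy Σ_{j=1}^{i−1}|𝒫_j| ≤ |T| ≤ Σ_{j=1}^{i}|𝒫_j| − 1. Then the family C_T = {X ∈ ℱ : X ∩ [m] = T} satisfies |C_T| ≤ |𝒫_i|·(n+1). -/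
open Finset

/-- The linear sum `𝒫_l*⋯*𝒫_1` (component `0` at the bottom), where component `i`
has `sz i` elements and is a chain if `isC i = true` and an antichain otherwise.
Carrier: pairs `(i, a)` with `a < sz i`. -/
def MPoset (l : ℕ) (sz : Fin l → ℕ) (isC : Fin l → Bool) : Type :=
  {p : Fin l × ℕ // p.2 < sz p.1}

instance (l : ℕ) (sz : Fin l → ℕ) (isC : Fin l → Bool) :
    PartialOrder (MPoset l sz isC) where
  le x y := x.1.1 < y.1.1 ∨
    (x.1.1 = y.1.1 ∧ x.1.2 ≤ y.1.2 ∧ (isC x.1.1 = false → y.1.2 ≤ x.1.2))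
  le_refl x := Or.inr ⟨rfl, le_rfl, fun _ => le_rfl⟩
  le_trans x y z hxy hyz := by
    rcases hxy with h | ⟨e1, h1, h1'⟩
    · rcases hyz with h' | ⟨e2, _, _⟩
      · exact Or.inl (h.trans h')
      · exact Or.inl (e2 ▸ h)
    · rcases hyz with h' | ⟨e2, h2, h2'⟩
      · exact Or.inl (e1 ▸ h')
      · refine Or.inr ⟨e1.trans e2, h1.trans h2, fun hc => ?_⟩
        exact (h2' (e1 ▸ hc)).trans (h1' hc)
  le_antisymm x y hxy hyx := by
    rcases hxy with h | ⟨e1, h1, _⟩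
    · rcases hyx with h' | ⟨e2, _, _⟩
      · exact absurd (h.trans h') (lt_irrefl _)
      · exact absurd h (by simp [e2])
    · rcases hyx with h' | ⟨e2, h2, _⟩
      · exact absurd h' (by simp [e1])
      · exact Subtype.ext (Prod.ext e1 (le_antisymm h1 h2))

/-- Sum of the sizes of the components strictly below component `i` (0-indexed):
`Σ_{j=1}^{i-1} |𝒫_j|` in the paper's 1-indexed notation. -/
def psum (l : ℕ) (sz : Fin l → ℕ) (i : ℕ) : ℕ :=
  ∑ j : Fin l, if (j : ℕ) < i then sz j else 0

/-- Sum of the sizes of the components strictly above component `i` (0-indexed):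
`Σ_{j=i+1}^{l} |𝒫_j|` in the paper's 1-indexed notation. -/
def ssum (l : ℕ) (sz : Fin l → ℕ) (i : ℕ) : ℕ :=
  ∑ j : Fin l, if i < (j : ℕ) then sz j else 0

/-- `m = (Σ_i |𝒫_i|) - 1`. -/
def mval (l : ℕ) (sz : Fin l → ℕ) : ℕ := (∑ j : Fin l, sz j) - 1

/-- `s ∈ T_i`: `T_i` is the singleton `{Σ_{j<i} sz j + 1}` if component `i` is an
antichain, and the interval `[Σ_{j<i} sz j + 1, Σ_{j≤i} sz j]` if it is a chain. -/
def memT (l : ℕ) (sz : Fin l → ℕ) (isC : Fin l → Bool) (i : Fin l) (s : ℕ) : Prop :=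
  if isC i then psum l sz i + 1 ≤ s ∧ s ≤ psum l sz i + sz i
  else s = psum l sz i + 1

/-- `s ∈ U_i`: `U_i` is the singleton `{Σ_{j>i} sz j + 1}` if component `i` is an
antichain, and the interval `[Σ_{j>i} sz j + 1, Σ_{j≥i} sz j]` if it is a chain. -/
def memU (l : ℕ) (sz : Fin l → ℕ) (isC : Fin l → Bool) (i : Fin l) (s : ℕ) : Prop :=
  if isC i then ssum l sz i + 1 ≤ s ∧ s ≤ ssum l sz i + sz i
  else s = ssum l sz i + 1

/-- The bottom family `ℱ_b`: subsets of `[m]` whose size lies in some `T_i`,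
`1 ≤ i ≤ l-1` (0-indexed: `i ≤ l-2`). -/
def Fbot (n l : ℕ) (sz : Fin l → ℕ) (isC : Fin l → Bool) : Set (Finset (Fin n)) :=
  {X | (∀ x ∈ X, (x : ℕ) < mval l sz) ∧
    ∃ i : Fin l, (i : ℕ) + 1 < l ∧ memT l sz isC i X.card}

/-- The top family `ℱ_t`: complements `[n] \ Y` of subsets `Y` of `[m]` whose size lies
in some `U_i`, `2 ≤ i ≤ l` (0-indexed: `1 ≤ i`). -/
def Ftop (n l : ℕ) (sz : Fin l → ℕ) (isC : Fin l → Bool) : Set (Finset (Fin n)) :=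
  {X | ∃ Y : Finset (Fin n), (∀ x ∈ Y, (x : ℕ) < mval l sz) ∧
    (∃ i : Fin l, 1 ≤ (i : ℕ) ∧ memU l sz isC i Y.card) ∧ X = Yᶜ}

/-- The `a`-th of the index sets realising a component with base `b`: nested initial segments
for a chain, one-point extensions of `range b` for an antichain. -/
def indexSet (c : Bool) (b a : ℕ) : Finset ℕ :=
  if c then range (b + a + 1) else insert (b + a) (range b)

lemma mem_indexSet {c : Bool} {b a x : ℕ} :
    x ∈ indexSet c b a ↔ x < b ∨ (c = true ∧ x ≤ b + a) ∨ x = b + a := by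
  cases c <;> simp [indexSet] <;> omega

lemma card_indexSet (c : Bool) (b a : ℕ) :
    (indexSet c b a).card = if c then b + a + 1 else b + 1 := by
  cases c <;> simp [indexSet]

lemma indexSet_subset_range {c : Bool} {b a s : ℕ} (h : b + a < s) :
    indexSet c b a ⊆ range s := by
  intro x hx
  rw [mem_indexSet] at hx
  rw [mem_range]
  omega

lemma indexSet_subset_iff {c : Bool} {b a a' : ℕ} :
    indexSet c b a ⊆ indexSet c b a' ↔ a ≤ a' ∧ (c = false → a' ≤ a) := by
  constructor
  · intro h
    have := mem_indexSet.1 (h (mem_indexSet.2 (Or.inr (Or.inr rfl))))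
    cases c <;> simp at this ⊢ <;> omega
  · rintro ⟨h₁, h₂⟩ x hx
    rw [mem_indexSet] at hx ⊢
    cases c <;> simp at hx h₂ ⊢ <;> omega

lemma indexSet_subset_of_lt {c c' : Bool} {b b' a a' : ℕ} (h : b + a < b') :
    indexSet c b a ⊆ indexSet c' b' a' := by
  intro x hx
  rw [mem_indexSet] at hx ⊢
  omega

lemma not_indexSet_subset_of_lt {c c' : Bool} {b b' a a' : ℕ} (h : b + a < b') :
    ¬ indexSet c' b' a' ⊆ indexSet c b a := by
  intro hs
  have := mem_indexSet.1 (hs (mem_indexSet.2 (Or.inr (Or.inr rfl))))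
  omega

lemma exists_enumeration {α : Type*} [Nonempty α] (S : Finset α) {s : ℕ} (hs : s ≤ S.card) :
    ∃ e : ℕ → α, (∀ a < s, e a ∈ S) ∧ Set.InjOn e (range s : Set ℕ) := by
  classical
  refine ⟨fun a => if h : a < S.card then (S.equivFin.symm ⟨a, h⟩ : α)
    else Classical.arbitrary α, fun a ha => ?_, fun a ha b hb hab => ?_⟩
  · simp [ha.trans_le hs]
  · have ha' : a < S.card := (mem_range.1 ha).trans_le hs
    have hb' : b < S.card := (mem_range.1 hb).trans_le hs
    simpa [ha', hb', Subtype.coe_inj] using hab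

lemma psum_add_le {l : ℕ} (sz : Fin l → ℕ) (j : Fin l) {i : ℕ} (h : (j : ℕ) < i) :
    psum l sz j + sz j ≤ psum l sz i := by
  have h₁ : sz j = ∑ x : Fin l, if x = j then sz x else 0 := by simp
  rw [psum, psum, h₁, ← sum_add_distrib]
  refine sum_le_sum fun x _ => ?_
  have := @Fin.ext_iff _ x j
  split_ifs <;> simp_all
  omega

lemma ssum_add_le {l : ℕ} (sz : Fin l → ℕ) (j : Fin l) {i : ℕ} (h : i < (j : ℕ)) :
    ssum l sz j + sz j ≤ ssum l sz i := by
  have h₁ : sz j = ∑ x : Fin l, if x = j then sz x else 0 := by simp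
  rw [ssum, ssum, h₁, ← sum_add_distrib]
  refine sum_le_sum fun x _ => ?_
  have := @Fin.ext_iff _ x j
  split_ifs <;> simp_all
  omega

lemma psum_add_add_ssum {l : ℕ} (sz : Fin l → ℕ) (i : Fin l) :
    psum l sz i + sz i + ssum l sz i = ∑ j, sz j := by
  have h₁ : sz i = ∑ x : Fin l, if x = i then sz x else 0 := by simp
  rw [psum, ssum, h₁, ← sum_add_distrib, ← sum_add_distrib]
  refine sum_congr rfl fun x _ => ?_
  have := @Fin.ext_iff _ x i
  split_ifs <;> simp_all <;> omega

/-- A map reflecting the order inside each component and strictly monotone between components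
yields an induced copy of the linear sum. -/
lemma containsCopy_of_components {n l : ℕ} {sz : Fin l → ℕ} {isC : Fin l → Bool}
    {F : Set (Finset (Fin n))} (f : Fin l → ℕ → Finset (Fin n))
    (hF : ∀ j, ∀ a < sz j, f j a ∈ F)
    (hlt : ∀ j j', j < j' → ∀ a < sz j, ∀ a' < sz j', f j a ⊆ f j' a' ∧ ¬ f j' a' ⊆ f j a)
    (heq : ∀ j, ∀ a < sz j, ∀ a' < sz j,
      f j a ⊆ f j a' ↔ a ≤ a' ∧ (isC j = false → a' ≤ a)) :
    ContainsCopy (MPoset l sz isC) F := by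
  have key : ∀ x y : MPoset l sz isC, x ≤ y ↔ f x.1.1 x.1.2 ⊆ f y.1.1 y.1.2 := by
    rintro ⟨⟨j, a⟩, ha⟩ ⟨⟨j', a'⟩, ha'⟩
    change (j < j' ∨ (j = j' ∧ a ≤ a' ∧ (isC j = false → a' ≤ a))) ↔ f j a ⊆ f j' a'
    rcases lt_trichotomy j j' with h | rfl | h
    · simp [h, (hlt j j' h a ha a' ha').1]
    · simp [heq j a ha a' ha']
    · simp [h.not_gt, h.ne', (hlt j' j h a' ha' a ha).2]
  refine ⟨fun x => f x.1.1 x.1.2, fun x y hxy => ?_, fun x => hF _ _ x.2, key⟩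
  have hxy' : f x.1.1 x.1.2 = f y.1.1 y.1.2 := hxy
  exact le_antisymm ((key x y).2 hxy'.subset) ((key y x).2 hxy'.symm.subset)

/-- An antichain of `sz i` members of `F` with trace `T` on `[m]` extends to an induced copy of
the linear sum, using subsets of `T` below it and complements of subsets of `[m] \ T` above. -/
lemma containsCopy_of_antichain_s17 {n l : ℕ} {sz : Fin l → ℕ} {isC : Fin l → Bool}
    (hsz : ∀ i, 2 ≤ sz i) (hn : 2 * mval l sz < n) {F : Set (Finset (Fin n))}
    (hsub : Fbot n l sz isC ∪ Ftop n l sz isC ⊆ F) (i : Fin l) (hi : isC i = false)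
    {T : Finset (Fin n)} (hTm : ∀ x ∈ T, (x : ℕ) < mval l sz)
    (hT1 : psum l sz i ≤ T.card) (hT2 : T.card ≤ psum l sz i + sz i - 1)
    (A : ℕ → Finset (Fin n)) (hAF : ∀ a < sz i, A a ∈ F)
    (hAT : ∀ a < sz i, (A a).filter (fun x : Fin n => (x : ℕ) < mval l sz) = T)
    (hA : ∀ a < sz i, ∀ a' < sz i, A a ⊆ A a' → a = a') :
    ContainsCopy (MPoset l sz isC) F := by
  have : NeZero n := ⟨by omega⟩
  set M : Finset (Fin n) := univ.filter (fun x => (x : ℕ) < mval l sz) with hM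
  have hMT : T ⊆ M := fun x hx => by simp [hM, hTm x hx]
  have hMcard : M.card = mval l sz := by
    rw [hM, Fin.card_filter_val_lt]
    omega
  have hRcard : ssum l sz i ≤ (M \ T).card := by
    rw [card_sdiff_of_subset hMT, hMcard, mval, ← psum_add_add_ssum sz i]
    have := hsz i
    omega
  obtain ⟨e, heT, he⟩ := exists_enumeration T hT1
  obtain ⟨e', heR, he'⟩ := exists_enumeration (M \ T) hRcard
  have hTA : ∀ a < sz i, T ⊆ A a := fun a ha => hAT a ha ▸ filter_subset _ _
  have hAR : ∀ a < sz i, A a ⊆ (M \ T)ᶜ := by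
    intro a ha x hx
    rw [mem_compl, mem_sdiff]
    rintro ⟨hxM, hxT⟩
    exact hxT (hAT a ha ▸ mem_filter.2 ⟨hx, (mem_filter.1 hxM).2⟩)
  have hother : ∀ a < sz i, ∃ a' < sz i, a' ≠ a := by
    intro a _
    have := hsz i
    rcases Nat.eq_zero_or_pos a with h | h
    · exact ⟨1, by omega, by omega⟩
    · exact ⟨0, by omega, by omega⟩
  have hAT' : ∀ a < sz i, ¬ A a ⊆ T := by
    intro a ha h
    obtain ⟨a', ha', hne⟩ := hother a ha
    exact hne (hA a ha a' ha' (h.trans (hTA a' ha'))).symm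
  have hAR' : ∀ a < sz i, ¬ (M \ T)ᶜ ⊆ A a := by
    intro a ha h
    obtain ⟨a', ha', hne⟩ := hother a ha
    exact hne (hA a' ha' a ha ((hAR a' ha').trans h))
  have hi0 : 0 < sz i := by have := hsz i; omega
  have hTR : T ⊆ (M \ T)ᶜ := (hTA 0 hi0).trans (hAR 0 hi0)
  have hTR' : ¬ (M \ T)ᶜ ⊆ T := fun h => hAR' 0 hi0 (h.trans (hTA 0 hi0))
  -- chains are reversed in the upper part, since complements are taken
  let r : Fin l → ℕ → ℕ := fun j a => if isC j then sz j - 1 - a else a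
  have hr : ∀ j, ∀ a < sz j, r j a < sz j := by
    intro j a ha
    simp only [r]
    split_ifs <;> omega
  let lower : Fin l → ℕ → Finset ℕ := fun j a => indexSet (isC j) (psum l sz j) a
  let upper : Fin l → ℕ → Finset ℕ := fun j a => indexSet (isC j) (ssum l sz j) (r j a)
  have hlower : ∀ j < i, ∀ a < sz j, lower j a ⊆ range (psum l sz i) := by
    intro j hj a ha
    have := psum_add_le sz j hj
    exact indexSet_subset_range (by omega)
  have hupper : ∀ j, i < j → ∀ a < sz j, upper j a ⊆ range (ssum l sz i) := by
    intro j hj a ha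
    have := ssum_add_le sz j hj
    have := hr j a ha
    exact indexSet_subset_range (by omega)
  have hlowerT : ∀ j < i, ∀ a < sz j, (lower j a).image e ⊆ T := by
    intro j hj a ha
    exact image_subset_iff.2 fun x hx => heT x (mem_range.1 (hlower j hj a ha hx))
  have hupperR : ∀ j, i < j → ∀ a < sz j, (upper j a).image e' ⊆ M \ T := by
    intro j hj a ha
    exact image_subset_iff.2 fun x hx => heR x (mem_range.1 (hupper j hj a ha hx))
  let f : Fin l → ℕ → Finset (Fin n) := fun j a =>
    if j < i then (lower j a).image e else if j = i then A a else ((upper j a).image e')ᶜ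
  have f_lower : ∀ j < i, ∀ a, f j a = (lower j a).image e := fun j hj a => by simp [f, hj]
  have f_mid : ∀ a, f i a = A a := fun a => by simp [f]
  have f_upper : ∀ j, i < j → ∀ a, f j a = ((upper j a).image e')ᶜ := fun j hj a => by
    simp [f, hj.not_gt, hj.ne']
  refine containsCopy_of_components f ?_ ?_ ?_
  · intro j a ha
    rcases lt_trichotomy j i with hj | rfl | hj
    · rw [f_lower j hj]
      refine hsub (Or.inl ⟨fun x hx => hTm x (hlowerT j hj a ha hx), j, by omega, ?_⟩)
      rw [card_image_of_injOn (he.mono (by exact_mod_cast hlower j hj a ha)), card_indexSet, memT]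
      split_ifs <;> omega
    · rw [f_mid]
      exact hAF a ha
    · rw [f_upper j hj]
      refine hsub (Or.inr ⟨_, fun x hx => ?_, ⟨j, by omega, ?_⟩, rfl⟩)
      · exact (mem_filter.1 (mem_sdiff.1 (hupperR j hj a ha hx)).1).2
      · rw [card_image_of_injOn (he'.mono (by exact_mod_cast hupper j hj a ha)), card_indexSet,
          memU]
        have := hr j a ha
        split_ifs <;> omega
  · intro j j' hjj a ha a' ha'
    rcases lt_trichotomy j i with hj | rfl | hj
    · rw [f_lower j hj]
      have h₁ := hlowerT j hj a ha
      rcases lt_trichotomy j' i with hj' | rfl | hj'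
      · have hlt : psum l sz j + a < psum l sz j' := by
          have := psum_add_le sz j hjj
          omega
        rw [f_lower j' hj',
          image_subset_image_iff_of_injOn he (hlower j hj a ha) (hlower j' hj' a' ha'),
          image_subset_image_iff_of_injOn he (hlower j' hj' a' ha') (hlower j hj a ha)]
        exact ⟨indexSet_subset_of_lt hlt, not_indexSet_subset_of_lt hlt⟩
      · rw [f_mid]
        exact ⟨h₁.trans (hTA a' ha'), fun h => hAT' a' ha' (h.trans h₁)⟩
      · rw [f_upper j' hj']
        have h₂ := compl_subset_compl.2 (hupperR j' hj' a' ha')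
        exact ⟨h₁.trans (hTR.trans h₂), fun h => hTR' (h₂.trans (h.trans h₁))⟩
    · rw [f_mid, f_upper j' hjj]
      have h₂ := compl_subset_compl.2 (hupperR j' hjj a' ha')
      exact ⟨(hAR a ha).trans h₂, fun h => hAR' a ha (h₂.trans h)⟩
    · have hj' := hj.trans hjj
      have hlt : ssum l sz j' + r j' a' < ssum l sz j := by
        have := ssum_add_le sz j' hjj
        have := hr j' a' ha'
        omega
      rw [f_upper j hj, f_upper j' hj', compl_subset_compl, compl_subset_compl,
        image_subset_image_iff_of_injOn he' (hupper j hj a ha) (hupper j' hj' a' ha'),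
        image_subset_image_iff_of_injOn he' (hupper j' hj' a' ha') (hupper j hj a ha)]
      exact ⟨indexSet_subset_of_lt hlt, not_indexSet_subset_of_lt hlt⟩
  · intro j a ha a' ha'
    rcases lt_trichotomy j i with hj | rfl | hj
    · rw [f_lower j hj, f_lower j hj,
        image_subset_image_iff_of_injOn he (hlower j hj a ha) (hlower j hj a' ha')]
      exact indexSet_subset_iff
    · rw [f_mid, f_mid]
      refine ⟨fun h => ?_, fun h => ?_⟩
      · have := hA a ha a' ha' h
        exact ⟨this.le, fun _ => this.ge⟩
      · rw [le_antisymm h.1 (h.2 hi)]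
    · rw [f_upper j hj, f_upper j hj, compl_subset_compl,
        image_subset_image_iff_of_injOn he' (hupper j hj a' ha') (hupper j hj a ha),
        indexSet_subset_iff]
      simp only [r]
      cases isC j <;> simp <;> omega

/-- in any `𝒫_l*⋯*𝒫_1`-saturated family `F` containing `ℱ_b ∪ ℱ_t`, for any
antichain component `i` and any `T ⊆ [m]` with `Σ_{j<i} sz j ≤ |T| ≤ Σ_{j≤i} sz j - 1`,
the family `C_T = {X ∈ F : X ∩ [m] = T}` has size at most `|𝒫_i| (n+1)`. -/
theorem statement17 {n l : ℕ} (sz : Fin l → ℕ) (isC : Fin l → Bool)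
    (hl : 1 ≤ l) (hsz : ∀ i, 2 ≤ sz i)
    (hcc : ∀ (i : Fin l) (h : (i : ℕ) + 1 < l),
      ¬ (isC i = true ∧ isC ⟨(i : ℕ) + 1, h⟩ = true))
    (hn : 2 * mval l sz < n)
    (F : Finset (Finset (Fin n)))
    (hsat : IsSaturated (MPoset l sz isC) F)
    (hsub : Fbot n l sz isC ∪ Ftop n l sz isC ⊆ (↑F : Set (Finset (Fin n))))
    (i : Fin l) (hi : isC i = false)
    (T : Finset (Fin n)) (hTm : ∀ x ∈ T, (x : ℕ) < mval l sz)
    (hT1 : psum l sz i ≤ T.card) (hT2 : T.card ≤ psum l sz i + sz i - 1) :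
    (F.filter (fun X => X.filter (fun x => (x : ℕ) < mval l sz) = T)).card
      ≤ sz i * (n + 1) := by
  set C := F.filter (fun X => X.filter (fun x => (x : ℕ) < mval l sz) = T)
  by_contra! hlarge
  have hmaps : ∀ X ∈ C, X.card ∈ range (n + 1) := fun X _ =>
    mem_range.2 (Nat.lt_succ_of_le (card_finset_fin_le X))
  obtain ⟨s, -, hs⟩ := exists_lt_card_fiber_of_mul_lt_card_of_maps_to hmaps
    (n := sz i) (by rw [card_range, mul_comm]; exact hlarge)
  obtain ⟨A, hAmem, hAinj⟩ := exists_enumeration _ hs.le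
  have hAmem' : ∀ a < sz i, (A a ∈ F ∧
      (A a).filter (fun x : Fin n => (x : ℕ) < mval l sz) = T) ∧ (A a).card = s := by
    intro a ha
    simpa only [C, mem_filter] using hAmem a ha
  refine hsat.1 (containsCopy_of_antichain_s17 hsz hn hsub i hi hTm hT1 hT2 A
    (fun a ha => (hAmem' a ha).1.1) (fun a ha => (hAmem' a ha).1.2) fun a ha a' ha' h => ?_)
  refine hAinj (by simpa using ha) (by simpa using ha') (eq_of_subset_of_card_le h ?_)
  rw [(hAmem' a ha).2, (hAmem' a' ha').2]
end

section
/- For any positive integers n₁,…,n_k, there is a constant C (depending only on n₁,…,n_k) such that sat*(n, K_{n₁,…,n_k}) ≤ C·n for all n ≥ 1; that is, the induced saturation number of the complete multipartite poset K_{n₁,…,n_k} is O(n). Moreover, if some n_i ≥ 2, then in addition sat*(n, K_{n₁,…,n_k}) ≥ (n+1)/9 for all n ≥ 1, so sat*(n, K_{n₁,…,n_k}) = Θ(n). -/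
open Finset

/-- `g` realizes the layers `i ∈ I` of a complete multipartite poset with layer sizes `m i`
inside the family `F`. -/
structure LayeredCopy {α : Type*} (m : ℕ → ℕ) (I : Set ℕ) (F : Set (Finset α))
    (g : ℕ → ℕ → Finset α) : Prop where
  mem : ∀ i ∈ I, ∀ t < m i, g i t ∈ F
  anti : ∀ i ∈ I, ∀ t < m i, ∀ t' < m i, g i t ⊆ g i t' → t = t'
  lt : ∀ i ∈ I, ∀ j ∈ I, i < j → ∀ t < m i, ∀ t' < m j, g i t ⊂ g j t'

theorem LayeredCopy.mono {α : Type*} {m : ℕ → ℕ} {I J : Set ℕ} {F : Set (Finset α)}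
    {g : ℕ → ℕ → Finset α} (h : LayeredCopy m J F g) (hIJ : I ⊆ J) : LayeredCopy m I F g :=
  ⟨fun i hi => h.mem i (hIJ hi), fun i hi => h.anti i (hIJ hi),
    fun i hi j hj => h.lt i (hIJ hi) j (hIJ hj)⟩

theorem LayeredCopy.of_mem {α : Type*} {m : ℕ → ℕ} {I : Set ℕ} {F G : Set (Finset α)}
    {g : ℕ → ℕ → Finset α} (h : LayeredCopy m I G g)
    (hF : ∀ i ∈ I, ∀ t < m i, g i t ∈ F) : LayeredCopy m I F g :=
  ⟨hF, h.anti, h.lt⟩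

theorem LayeredCopy.glue {α : Type*} {m : ℕ → ℕ} {j k : ℕ} {F : Set (Finset α)}
    {g₁ g₂ : ℕ → ℕ → Finset α} (h₁ : LayeredCopy m (Set.Iio j) F g₁)
    (h₂ : LayeredCopy m (Set.Ico j k) F g₂)
    (h : ∀ i < j, ∀ i', j ≤ i' → i' < k → ∀ t < m i, ∀ t' < m i', g₁ i t ⊂ g₂ i' t') :
    LayeredCopy m (Set.Iio k) F (fun i t => if i < j then g₁ i t else g₂ i t) := by
  refine ⟨fun i hi t ht => ?_, fun i hi t ht t' ht' hs => ?_, fun i hi i' hi' hlt t ht t' ht' => ?_⟩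
  · by_cases hj : i < j
    · simpa [hj] using h₁.mem i hj t ht
    · simpa [hj] using h₂.mem i ⟨not_lt.1 hj, hi⟩ t ht
  · by_cases hj : i < j
    · exact h₁.anti i hj t ht t' ht' (by simpa [hj] using hs)
    · exact h₂.anti i ⟨not_lt.1 hj, hi⟩ t ht t' ht' (by simpa [hj] using hs)
  · by_cases hj' : i' < j
    · simpa [hj', hlt.trans hj'] using h₁.lt i (hlt.trans hj') i' hj' hlt t ht t' ht'
    · by_cases hj : i < j
      · simpa [hj, hj'] using h i hj i' (not_lt.1 hj') hi' t ht t' ht'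
      · simpa [hj, hj'] using
          h₂.lt i ⟨not_lt.1 hj, hi⟩ i' ⟨not_lt.1 hj', hi'⟩ hlt t ht t' ht'

theorem containsCopy_iff {k n : ℕ} {sz : Fin k → ℕ} {m : ℕ → ℕ} (hm : ∀ i : Fin k, m i = sz i)
    (F : Set (Finset (Fin n))) :
    ContainsCopy (MPoset k sz fun _ => false) F ↔ ∃ g, LayeredCopy m (Set.Iio k) F g := by
  constructor
  · rintro ⟨f, -, hF, hf⟩
    have hval : ∀ i (hi : i < k) t, t < m i → t < sz ⟨i, hi⟩ := fun i hi t ht => by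
      rw [← hm ⟨i, hi⟩]; exact ht
    let g : ℕ → ℕ → Finset (Fin n) := fun i t =>
      if h : ∃ hi : i < k, t < sz ⟨i, hi⟩ then f ⟨(⟨i, h.1⟩, t), h.2⟩ else ∅
    have hg : ∀ i (hi : i < k) t (ht : t < m i),
        g i t = f ⟨(⟨i, hi⟩, t), hval i hi t ht⟩ := fun i hi t ht =>
      dif_pos ⟨hi, hval i hi t ht⟩
    refine ⟨g, fun i hi t ht => ?_, fun i hi t ht t' ht' hs => ?_,
      fun i hi i' hi' hlt t ht t' ht' => ?_⟩
    · rw [hg i hi t ht]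
      exact hF _
    · rw [hg i hi t ht, hg i hi t' ht'] at hs
      rcases (hf _ _).2 hs with h | ⟨-, h1, h2⟩
      · exact absurd h (lt_irrefl _)
      · exact le_antisymm h1 (h2 rfl)
    · rw [hg i hi t ht, hg i' hi' t' ht', Finset.ssubset_iff_subset_ne]
      refine ⟨(hf _ _).1 (Or.inl hlt), fun he => ?_⟩
      rcases (hf _ _).2 he.ge with h | ⟨h, -⟩
      · exact absurd (Fin.lt_def.1 h) (not_lt.2 hlt.le)
      · exact absurd (congrArg Fin.val h) hlt.ne'
  · rintro ⟨g, hg⟩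
    have hlt : ∀ p : MPoset k sz fun _ => false, p.1.2 < m p.1.1 := fun p => by
      rw [hm]; exact p.2
    have hiff : ∀ p q : MPoset k sz fun _ => false,
        p ≤ q ↔ g p.1.1 p.1.2 ⊆ g q.1.1 q.1.2 := fun p q => by
      constructor
      · rintro (h | ⟨h, h1, h2⟩)
        · exact (hg.lt _ p.1.1.2 _ q.1.1.2 h _ (hlt p) _ (hlt q)).subset
        · rw [h, le_antisymm h1 (h2 rfl)]
      · intro h
        rcases lt_trichotomy p.1.1 q.1.1 with h' | h' | h'
        · exact Or.inl h'
        · have hq := hlt q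
          rw [← h'] at h hq
          have := hg.anti _ p.1.1.2 _ (hlt p) _ hq h
          exact Or.inr ⟨h', this.le, fun _ => this.ge⟩
        · exact absurd h (hg.lt _ q.1.1.2 _ p.1.1.2 h' _ (hlt q) _ (hlt p)).not_subset
    refine ⟨fun p => g p.1.1 p.1.2, fun p q h => ?_, fun p => hg.mem _ p.1.1.2 _ (hlt p), hiff⟩
    exact le_antisymm ((hiff p q).2 (le_of_eq h)) ((hiff q p).2 (le_of_eq h.symm))

/-- Every family without a copy of `P` extends to a `P`-saturated one. -/
theorem exists_isSaturated_superset {P : Type} [PartialOrder P] {n : ℕ}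
    (F₀ : Finset (Finset (Fin n))) (h₀ : ¬ ContainsCopy P (F₀ : Set (Finset (Fin n)))) :
    ∃ F, F₀ ⊆ F ∧ IsSaturated P F := by
  classical
  obtain ⟨F, hle, hF⟩ := (Set.toFinite
    {F : Finset (Finset (Fin n)) | ¬ ContainsCopy P (F : Set (Finset (Fin n)))}).exists_le_maximal h₀
  refine ⟨F, hle, hF.1, fun S hS => ?_⟩
  by_contra hc
  have := hF.2 (y := insert S F) (by simpa using hc) (Finset.subset_insert S F)
  exact hS (this (Finset.mem_insert_self S F))

theorem satStar_le {P : Type} [PartialOrder P] {n : ℕ} {F : Finset (Finset (Fin n))}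
    (hF : IsSaturated P F) : satStar n P ≤ F.card :=
  Nat.sInf_le ⟨F, hF, rfl⟩

theorem exists_isSaturated_card_eq {P : Type} [PartialOrder P] [Nonempty P] (n : ℕ) :
    ∃ F : Finset (Finset (Fin n)), IsSaturated P F ∧ F.card = satStar n P := by
  obtain ⟨F, -, hF⟩ := exists_isSaturated_superset (P := P) (∅ : Finset (Finset (Fin n)))
    (fun ⟨f, _, hf, _⟩ => by simpa using hf (Classical.arbitrary P))
  exact Nat.sInf_mem (s := {m | ∃ F : Finset (Finset (Fin n)), IsSaturated P F ∧ F.card = m})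
    ⟨_, F, hF, rfl⟩

/-- The layers below `j` can be realized inside `F` by subsets of `S`. -/
def HasBelow {α : Type*} (m : ℕ → ℕ) (F : Set (Finset α)) (j : ℕ) (S : Finset α) : Prop :=
  ∃ g, LayeredCopy m (Set.Iio j) F g ∧ ∀ i < j, ∀ t < m i, g i t ⊆ S

/-- The layers from `j` up to `k - 1` can be realized inside `F` by supersets of `S`. -/
def HasAbove {α : Type*} (m : ℕ → ℕ) (F : Set (Finset α)) (j k : ℕ) (S : Finset α) : Prop :=
  ∃ g, LayeredCopy m (Set.Ico j k) F g ∧ ∀ i, j ≤ i → i < k → ∀ t < m i, S ⊆ g i t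

/-- `F` together with `S` contains a copy in which `S` occupies position `t₀` of layer `j`. -/
structure CopyThrough {α : Type*} (m : ℕ → ℕ) (F : Set (Finset α)) (j k : ℕ) (S : Finset α)
    (g : ℕ → ℕ → Finset α) (t₀ : ℕ) : Prop where
  copy : LayeredCopy m (Set.Iio k) (insert S F) g
  lt : t₀ < m j
  eq : g j t₀ = S
  mem : ∀ i < k, ∀ t < m i, (i ≠ j ∨ t ≠ t₀) → g i t ∈ F

section Saturated

variable {α : Type*} {m : ℕ → ℕ} {F : Set (Finset α)} {j k : ℕ} {S T : Finset α}

theorem HasBelow.mono (h : HasBelow m F j S) (hST : S ⊆ T) : HasBelow m F j T := by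
  obtain ⟨g, hg, hS⟩ := h
  exact ⟨g, hg, fun i hi t ht => (hS i hi t ht).trans hST⟩

theorem HasAbove.anti (h : HasAbove m F j k T) (hST : S ⊆ T) : HasAbove m F j k S := by
  obtain ⟨g, hg, hS⟩ := h
  exact ⟨g, hg, fun i hi hi' t ht => hST.trans (hS i hi hi' t ht)⟩

theorem LayeredCopy.not_subset {I : Set ℕ} {g : ℕ → ℕ → Finset α} (hg : LayeredCopy m I F g)
    (hj : j ∈ I) (hm : 2 ≤ m j) {t : ℕ} (ht : t < m j) :
    ∃ t' < m j, ¬ g j t ⊆ g j t' ∧ ¬ g j t' ⊆ g j t := by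
  obtain ⟨t', ht', hne⟩ : ∃ t' < m j, t' ≠ t := by
    rcases Nat.eq_zero_or_pos t with rfl | h
    · exact ⟨1, by omega, by omega⟩
    · exact ⟨0, by omega, by omega⟩
  exact ⟨t', ht', fun h => hne (hg.anti j hj t ht t' ht' h).symm,
    fun h => hne (hg.anti j hj t' ht' t ht h)⟩

theorem HasAbove.strict (h : HasAbove m F j k S) (hj : j < k) (hm : 2 ≤ m j) :
    ∃ g, LayeredCopy m (Set.Ico j k) F g ∧ ∀ i, j ≤ i → i < k → ∀ t < m i, S ⊂ g i t := by
  obtain ⟨g, hg, hS⟩ := h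
  have hjm : j ∈ Set.Ico j k := ⟨le_rfl, hj⟩
  refine ⟨g, hg, fun i hi hi' t ht => ?_⟩
  rcases hi.eq_or_lt with rfl | hlt
  · obtain ⟨t', ht', h1, -⟩ := hg.not_subset hjm hm ht
    exact (hS j le_rfl hj t ht).ssubset_of_ne fun h => h1 (h ▸ hS j le_rfl hj t' ht')
  · exact (hS j le_rfl hj 0 (by omega)).trans_ssubset
      (hg.lt j hjm i ⟨hi, hi'⟩ hlt 0 (by omega) t ht)

theorem HasBelow.strict (h : HasBelow m F (j + 1) S) (hm : 2 ≤ m j) :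
    ∃ g, LayeredCopy m (Set.Iio (j + 1)) F g ∧ ∀ i < j + 1, ∀ t < m i, g i t ⊂ S := by
  obtain ⟨g, hg, hS⟩ := h
  have hjm : j ∈ Set.Iio (j + 1) := Nat.lt_succ_self j
  refine ⟨g, hg, fun i hi t ht => ?_⟩
  rcases (Nat.lt_succ_iff.1 hi).eq_or_lt with rfl | hlt
  · obtain ⟨t', ht', -, h1⟩ := hg.not_subset hjm hm ht
    exact (hS i hi t ht).ssubset_of_ne fun h => h1 (h ▸ hS i hi t' ht')
  · exact (hg.lt i hi j hjm hlt t ht 0 (by omega)).trans_subset (hS j hjm 0 (by omega))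

theorem HasBelow.not_hasAbove (hfree : ∀ g, ¬ LayeredCopy m (Set.Iio k) F g) (hj : j < k)
    (hm : 2 ≤ m j) (h : HasBelow m F j S) : ¬ HasAbove m F j k S := by
  rintro h'
  obtain ⟨g, hg, hS⟩ := h
  obtain ⟨g', hg', hS'⟩ := h'.strict hj hm
  exact hfree _ (hg.glue hg' fun i hi i' hi' hk t ht t' ht' =>
    (hS i hi t ht).trans_ssubset (hS' i' hi' hk t' ht'))

theorem HasAbove.not_hasBelow (hfree : ∀ g, ¬ LayeredCopy m (Set.Iio k) F g)
    (hm : 2 ≤ m j) (h : HasAbove m F (j + 1) k S) : ¬ HasBelow m F (j + 1) S := by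
  rintro h'
  obtain ⟨g, hg, hS⟩ := h
  obtain ⟨g', hg', hS'⟩ := h'.strict hm
  exact hfree _ (hg'.glue hg fun i hi i' hi' hk t ht t' ht' =>
    (hS' i hi t ht).trans_subset (hS i' hi' hk t' ht'))

variable {g : ℕ → ℕ → Finset α} {t₀ : ℕ}

theorem CopyThrough.ssubset (h : CopyThrough m F j k S g t₀) (hj : j < k) {i : ℕ} (hi : i < j)
    {t : ℕ} (ht : t < m i) : g i t ⊂ S :=
  h.eq ▸ h.copy.lt i (hi.trans hj) j hj hi t ht t₀ h.lt

theorem CopyThrough.lower (h : CopyThrough m F j k S g t₀) (hj : j < k) :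
    LayeredCopy m (Set.Iio j) F g :=
  (h.copy.mono (Set.Iio_subset_Iio hj.le)).of_mem fun i hi t ht =>
    h.mem i (lt_trans hi hj) t ht (Or.inl (ne_of_lt hi))

theorem CopyThrough.upper (h : CopyThrough m F j k S g t₀) :
    LayeredCopy m (Set.Ico (j + 1) k) F g :=
  (h.copy.mono fun _ hi => hi.2).of_mem fun i hi t ht =>
    h.mem i hi.2 t ht (Or.inl (ne_of_gt hi.1))

theorem CopyThrough.hasBelow (h : CopyThrough m F j k S g t₀) (hj : j < k) :
    HasBelow m F j S :=
  ⟨g, h.lower hj, fun _ hi _ ht => (h.ssubset hj hi ht).subset⟩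

theorem CopyThrough.hasAbove (h : CopyThrough m F j k S g t₀) (hj : j < k) :
    HasAbove m F (j + 1) k S :=
  ⟨g, h.upper, fun i hi hi' t ht =>
    h.eq ▸ (h.copy.lt j hj i hi' hi t₀ h.lt t ht).subset⟩

theorem hasAbove_or_hasBelow_or_copyThrough (hfree : ∀ g, ¬ LayeredCopy m (Set.Iio k) F g)
    (hsat : ∀ S ∉ F, ∃ g, LayeredCopy m (Set.Iio k) (insert S F) g) (hj : j < k) (hS : S ∉ F) :
    HasAbove m F j k S ∨ HasBelow m F (j + 1) S ∨ ∃ g t₀, CopyThrough m F j k S g t₀ := by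
  obtain ⟨g, hg⟩ := hsat S hS
  obtain ⟨i₀, hi₀, t₀, ht₀, he⟩ : ∃ i₀ < k, ∃ t₀ < m i₀, g i₀ t₀ = S := by
    by_contra! hc
    exact hfree g (hg.of_mem fun i hi t ht => (hg.mem i hi t ht).resolve_left (hc i hi t ht))
  have hmem : ∀ i < k, ∀ t < m i, (i ≠ i₀ ∨ t ≠ t₀) → g i t ∈ F := fun i hi t ht hne => by
    refine (hg.mem i hi t ht).resolve_left fun h => ?_
    rw [← he] at h
    rcases lt_trichotomy i i₀ with hlt | rfl | hlt
    · exact (hg.lt i hi i₀ hi₀ hlt t ht t₀ ht₀).ne h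
    · exact hne.elim (fun h => h rfl) fun hn => hn (hg.anti i hi t ht t₀ ht₀ h.subset)
    · exact (hg.lt i₀ hi₀ i hi hlt t₀ ht₀ t ht).ne h.symm
  rcases lt_trichotomy i₀ j with hlt | rfl | hlt
  · exact Or.inl ⟨g, (hg.mono fun _ hi => hi.2).of_mem fun i hi t ht =>
      hmem i hi.2 t ht (Or.inl (hlt.trans_le hi.1).ne'), fun i hi hi' t ht =>
      he ▸ (hg.lt i₀ hi₀ i hi' (hlt.trans_le hi) t₀ ht₀ t ht).subset⟩
  · exact Or.inr (Or.inr ⟨g, t₀, hg, ht₀, he, hmem⟩)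
  · exact Or.inr (Or.inl ⟨g, (hg.mono fun i hi => lt_of_lt_of_le hi hj).of_mem fun i hi t ht =>
      hmem i (lt_of_lt_of_le hi hj) t ht (Or.inl (lt_of_lt_of_le hi hlt).ne), fun i hi t ht =>
      he ▸ (hg.lt i (lt_of_lt_of_le hi hj) i₀ hi₀ (lt_of_lt_of_le hi hlt) t ht t₀ ht₀).subset⟩)

/-- A pair of disjoint nonempty sets that the family `F` does not separate: this is the sign
pattern of a vector orthogonal to the indicators of `F` and of the ground set. -/
structure SignPair [DecidableEq α] (F : Set (Finset α)) (P N : Finset α) : Prop where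
  disj : Disjoint P N
  pos : P.Nonempty
  neg : N.Nonempty
  disj_pos : ∀ C ∈ F, Disjoint C N → Disjoint C P
  disj_neg : ∀ C ∈ F, Disjoint C P → Disjoint C N
  sub_neg : ∀ C ∈ F, P ⊆ C → N ⊆ C
  sub_pos : ∀ C ∈ F, N ⊆ C → P ⊆ C
  union : ∀ E ∈ F, E ∪ P ∈ F → P ⊆ E

variable [DecidableEq α] {P N : Finset α}

theorem SignPair.hasAbove_union (hPN : SignPair F P N)
    (hfree : ∀ g, ¬ LayeredCopy m (Set.Iio k) F g)
    (hsat : ∀ S ∉ F, ∃ g, LayeredCopy m (Set.Iio k) (insert S F) g) (hj : j < k) (hm : 2 ≤ m j)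
    (hS : HasAbove m F j k S) : HasAbove m F j k (S ∪ (P ∪ N)) := by
  have hd : Disjoint (S \ (P ∪ N) ∪ P) N := by
    have := hPN.disj
    rw [Finset.disjoint_left] at this ⊢
    intro v
    simp only [Finset.mem_union, Finset.mem_sdiff]
    grind
  have hS₁ : S \ (P ∪ N) ∪ P ∉ F := fun h => by
    obtain ⟨v, hv⟩ := hPN.pos
    exact Finset.disjoint_left.1 (hPN.disj_pos _ h hd) (Finset.mem_union_right _ hv) hv
  have key : HasBelow m F j (S \ (P ∪ N) ∪ P) → False := by
    rintro ⟨g, hg, hgS⟩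
    refine HasBelow.not_hasAbove hfree hj hm (S := S) ⟨g, hg, fun i hi t ht v hv => ?_⟩ hS
    have h1 := hPN.disj_pos _ (hg.mem i hi t ht) (hd.mono_left (hgS i hi t ht))
    have h2 := hgS i hi t ht hv
    have h3 := Finset.disjoint_left.1 h1 hv
    simp only [Finset.mem_union, Finset.mem_sdiff] at h2
    tauto
  rcases hasAbove_or_hasBelow_or_copyThrough hfree hsat hj hS₁ with ⟨g, hg, hgS⟩ | h | ⟨g, t, h⟩
  · refine ⟨g, hg, fun i hi hi' t ht => ?_⟩
    have h1 := hgS i hi hi' t ht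
    have h2 := hPN.sub_neg _ (hg.mem i ⟨hi, hi'⟩ t ht) (Finset.subset_union_right.trans h1)
    intro v hv
    have h3 := @h1 v
    have h4 := @h2 v
    simp only [Finset.mem_union, Finset.mem_sdiff] at h3 hv
    tauto
  · obtain ⟨g, hg, hgS⟩ := h
    exact (key ⟨g, hg.mono fun _ hi => Nat.lt_succ_of_lt hi,
      fun i hi t ht => hgS i (Nat.lt_succ_of_lt hi) t ht⟩).elim
  · exact (key (h.hasBelow hj)).elim

theorem SignPair.hasBelow_sdiff (hPN : SignPair F P N)
    (hfree : ∀ g, ¬ LayeredCopy m (Set.Iio k) F g)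
    (hsat : ∀ S ∉ F, ∃ g, LayeredCopy m (Set.Iio k) (insert S F) g) (hj : j < k) (hm : 2 ≤ m j)
    (hS : HasBelow m F (j + 1) S) : HasBelow m F (j + 1) (S \ (P ∪ N)) := by
  have hN : N ⊆ (S ∪ (P ∪ N)) \ P := fun v hv => by
    have := Finset.disjoint_right.1 hPN.disj hv
    simp [hv, this]
  have hS₁ : (S ∪ (P ∪ N)) \ P ∉ F := fun h => by
    obtain ⟨v, hv⟩ := hPN.pos
    exact (Finset.mem_sdiff.1 (hPN.sub_pos _ h hN hv)).2 hv
  have key : HasAbove m F (j + 1) k ((S ∪ (P ∪ N)) \ P) → False := by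
    rintro ⟨g, hg, hgS⟩
    refine HasAbove.not_hasBelow hfree hm (S := S) ⟨g, hg, fun i hi hi' t ht v hv => ?_⟩ hS
    have h1 := hgS i hi hi' t ht
    have h2 := hPN.sub_pos _ (hg.mem i ⟨hi, hi'⟩ t ht) (hN.trans h1)
    have h3 := @h1 v
    have h4 := @h2 v
    simp only [Finset.mem_union, Finset.mem_sdiff] at h3
    tauto
  rcases hasAbove_or_hasBelow_or_copyThrough hfree hsat hj hS₁ with ⟨g, hg, hgS⟩ | h | ⟨g, t, h⟩
  · exact (key ⟨g, hg.mono fun _ hi => ⟨Nat.le_of_succ_le hi.1, hi.2⟩,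
      fun i hi hi' t ht => hgS i (Nat.le_of_succ_le hi) hi' t ht⟩).elim
  · obtain ⟨g, hg, hgS⟩ := h
    refine ⟨g, hg, fun i hi t ht v hv => ?_⟩
    have h1 := hgS i hi t ht
    have h2 := hPN.disj_neg _ (hg.mem i hi t ht)
      (Finset.disjoint_left.2 fun w hw => (Finset.mem_sdiff.1 (h1 hw)).2)
    have h3 := h1 hv
    have h4 := Finset.disjoint_left.1 h2 hv
    simp only [Finset.mem_union, Finset.mem_sdiff] at h3 ⊢
    tauto
  · exact (key (h.hasAbove hj)).elim

/-- In a saturated family with a sign pair, some member that does not contain the whole pair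
has neither the layers from `j` upwards above it, nor the layers up to `j` below it. -/
theorem SignPair.exists_mem [Fintype α] (hPN : SignPair F P N)
    (hfree : ∀ g, ¬ LayeredCopy m (Set.Iio k) F g)
    (hsat : ∀ S ∉ F, ∃ g, LayeredCopy m (Set.Iio k) (insert S F) g) (hj : j < k)
    (hm : 2 ≤ m j) :
    ∃ E ∈ F, ¬ HasAbove m F j k E ∧ ¬ HasBelow m F (j + 1) E ∧ ¬ P ∪ N ⊆ E := by
  obtain ⟨T, hT⟩ := (Set.toFinite {S : Finset α | ¬ HasAbove m F j k S}).exists_minimal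
    ⟨Finset.univ, fun h => by
      obtain ⟨g, -, hg⟩ := h.strict hj hm
      exact (hg j le_rfl hj 0 (by omega)).not_subset (Finset.subset_univ _)⟩
  have hTa : ¬ HasAbove m F j k T := hT.1
  have hTmin : ∀ S ⊆ T, ¬ HasAbove m F j k S → T ⊆ S := fun S hS h => hT.2 h hS
  have hTb : ¬ HasBelow m F (j + 1) T := fun h => by
    obtain ⟨g, hg, hgT⟩ := h.strict hm
    have h0 := hgT j (Nat.lt_succ_self j) 0 (by omega)
    have hb : HasBelow m F j (g j 0) := ⟨g, hg.mono fun _ hi => Nat.lt_succ_of_lt hi,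
      fun i hi t ht => (hg.lt i (Nat.lt_succ_of_lt hi) j (Nat.lt_succ_self j) hi t ht 0
        (by omega)).subset⟩
    exact h0.not_subset (hTmin _ h0.subset (hb.not_hasAbove hfree hj hm))
  have hTd : Disjoint T (P ∪ N) := by
    have h : T ⊆ T \ (P ∪ N) := hTmin _ Finset.sdiff_subset fun h =>
      hTa ((hPN.hasAbove_union hfree hsat hj hm h).anti fun v hv => by
        simp only [Finset.mem_union, Finset.mem_sdiff]; tauto)
    exact Finset.disjoint_left.2 fun v hv => (Finset.mem_sdiff.1 (h hv)).2
  have hd : Disjoint (T ∪ P) N := Finset.disjoint_union_left.2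
    ⟨(Finset.disjoint_union_right.1 hTd).2, hPN.disj⟩
  have hS₁ : T ∪ P ∉ F := fun h => by
    obtain ⟨v, hv⟩ := hPN.pos
    exact Finset.disjoint_left.1 (hPN.disj_pos _ h hd) (Finset.mem_union_right _ hv) hv
  rcases hasAbove_or_hasBelow_or_copyThrough hfree hsat hj hS₁ with h | h | ⟨g, t₀, h⟩
  · exact (hTa (h.anti Finset.subset_union_left)).elim
  · exact (hTb ((hPN.hasBelow_sdiff hfree hsat hj hm h).mono fun v hv => by
      simp only [Finset.mem_union, Finset.mem_sdiff] at hv; tauto)).elim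
  obtain ⟨t₁, ht₁, hn₁, hn₂⟩ := h.copy.not_subset hj hm h.lt
  have hne : t₁ ≠ t₀ := fun e => hn₁ (e ▸ subset_rfl)
  have hD : g j t₁ ∈ F := h.mem j hj t₁ ht₁ (Or.inr hne)
  have hDb : HasBelow m F j (g j t₁ ∩ T) := ⟨g, h.lower hj, fun i hi t ht v hv => by
    have h1 := (h.ssubset hj hi ht).subset
    have h2 := hPN.disj_pos _ ((h.lower hj).mem i hi t ht) (hd.mono_left h1)
    have h3 := Finset.disjoint_left.1 h2 hv
    exact Finset.mem_inter.2 ⟨(h.copy.lt i (hi.trans hj) j hj hi t ht t₁ ht₁).subset hv,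
      (Finset.mem_union.1 (h1 hv)).resolve_right h3⟩⟩
  have hTD : T ⊆ g j t₁ := (hTmin _ Finset.inter_subset_right
    (hDb.not_hasAbove hfree hj hm)).trans Finset.inter_subset_left
  refine ⟨g j t₁, hD, (hDb.mono Finset.inter_subset_left).not_hasAbove hfree hj hm,
    HasAbove.not_hasBelow hfree hm ⟨g, h.upper, fun i hi hi' t ht =>
      (h.copy.lt j hj i hi' hi t₁ ht₁ t ht).subset⟩, fun hY => hn₁ ?_⟩
  rw [h.eq]
  exact Finset.union_subset hTD (Finset.subset_union_left.trans hY)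

theorem not_signPair [Fintype α] (hfree : ∀ g, ¬ LayeredCopy m (Set.Iio k) F g)
    (hsat : ∀ S ∉ F, ∃ g, LayeredCopy m (Set.Iio k) (insert S F) g) (hj : j < k)
    (hm : 2 ≤ m j) : ¬ SignPair F P N := by
  intro hPN
  obtain ⟨E, hE⟩ := (Set.toFinite {E : Finset α | E ∈ F ∧ ¬ HasAbove m F j k E ∧
    ¬ HasBelow m F (j + 1) E ∧ ¬ P ∪ N ⊆ E}).exists_maximal
    (hPN.exists_mem hfree hsat hj hm)
  obtain ⟨⟨hEF, hEa, hEb, hEY⟩, hmax⟩ := hE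
  have hEP : ¬ P ⊆ E := fun h => hEY (Finset.union_subset h (hPN.sub_neg E hEF h))
  have hTF : E ∪ P ∉ F := fun h => hEP (hPN.union E hEF h)
  have hTb : ¬ HasBelow m F (j + 1) (E ∪ P) := fun h =>
    hEb ((hPN.hasBelow_sdiff hfree hsat hj hm h).mono fun v hv => by
      simp only [Finset.mem_union, Finset.mem_sdiff] at hv; tauto)
  rcases hasAbove_or_hasBelow_or_copyThrough hfree hsat hj hTF with h | h | ⟨g, t₀, h⟩
  · exact hEa (h.anti Finset.subset_union_left)
  · exact hTb h
  have hEg : ∀ t < m j, t ≠ t₀ → ¬ E ⊆ g j t ∧ ¬ g j t ⊆ E := fun t ht hne => by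
    have hDF : g j t ∈ F := h.mem j hj t ht (Or.inr hne)
    have hDa : ¬ HasAbove m F j k (g j t) :=
      HasBelow.not_hasAbove hfree hj hm ⟨g, h.lower hj, fun i hi t' ht' =>
        (h.copy.lt i (hi.trans hj) j hj hi t' ht' t ht).subset⟩
    have hDb : ¬ HasBelow m F (j + 1) (g j t) :=
      HasAbove.not_hasBelow hfree hm ⟨g, h.upper, fun i hi hi' t' ht' =>
        (h.copy.lt j hj i hi' hi t ht t' ht').subset⟩
    constructor
    · intro hs
      have hDY : P ⊆ g j t := by
        by_contra hc
        have := hmax (y := g j t)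
          ⟨hDF, hDa, hDb, fun h' => hc (Finset.subset_union_left.trans h')⟩ hs
        have he : E = g j t := subset_antisymm hs this
        refine hne (h.copy.anti j hj t ht t₀ h.lt ?_)
        rw [h.eq, ← he]
        exact Finset.subset_union_left
      refine hne (h.copy.anti j hj t₀ h.lt t ht ?_).symm
      rw [h.eq]
      exact Finset.union_subset hs hDY
    · intro hs
      refine hne (h.copy.anti j hj t ht t₀ h.lt ?_)
      rw [h.eq]
      exact hs.trans Finset.subset_union_left
  let g₂ : ℕ → ℕ → Finset α := fun i t => if i = j ∧ t = t₀ then E else g i t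
  have hg₂E : g₂ j t₀ = E := if_pos ⟨rfl, rfl⟩
  have hg₂j : ∀ t, t ≠ t₀ → g₂ j t = g j t := fun t ht => if_neg fun h => ht h.2
  have hg₂ : ∀ i, i ≠ j → ∀ t, g₂ i t = g i t := fun i hi t => if_neg fun h => hi h.1
  have hcopy : LayeredCopy m (Set.Ico j k) F g₂ := by
    refine ⟨fun i hi t ht => ?_, fun i hi t ht t' ht' hs => ?_,
      fun i hi i' hi' hlt t ht t' ht' => ?_⟩
    · by_cases hc : i = j ∧ t = t₀
      · rw [hc.1, hc.2, hg₂E]; exact hEF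
      · have : g₂ i t = g i t := if_neg hc
        rw [this]
        exact h.mem i hi.2 t ht (by tauto)
    · rcases eq_or_ne i j with rfl | hij
      · by_cases h1 : t = t₀ <;> by_cases h2 : t' = t₀
        · rw [h1, h2]
        · rw [h1, hg₂E, hg₂j _ h2] at hs
          exact ((hEg t' ht' h2).1 hs).elim
        · rw [h2, hg₂E, hg₂j _ h1] at hs
          exact ((hEg t ht h1).2 hs).elim
        · rw [hg₂j _ h1, hg₂j _ h2] at hs
          exact h.copy.anti i hi.2 t ht t' ht' hs
      · rw [hg₂ i hij, hg₂ i hij] at hs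
        exact h.copy.anti i hi.2 t ht t' ht' hs
    · have hlt' := h.copy.lt i hi.2 i' hi'.2 hlt
      have hi'j : i' ≠ j := (hi.1.trans_lt hlt).ne'
      rw [hg₂ i' hi'j]
      by_cases hc : i = j ∧ t = t₀
      · obtain ⟨rfl, rfl⟩ := hc
        rw [hg₂E]
        refine Finset.ssubset_of_subset_of_ssubset (Finset.subset_union_left (s₂ := P)) ?_
        exact h.eq ▸ hlt' t ht t' ht'
      · have : g₂ i t = g i t := if_neg hc
        rw [this]
        exact hlt' t ht t' ht'
  have hlow : ∃ i < j, ∃ t < m i, ¬ g i t ⊂ E := by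
    by_contra! hc
    refine hfree _ ((h.lower hj).glue hcopy fun i hi i' hi' hk t ht t' ht' => ?_)
    by_cases hc' : i' = j ∧ t' = t₀
    · rw [hc'.1, hc'.2, hg₂E]
      exact hc i hi t ht
    · have : g₂ i' t' = g i' t' := if_neg hc'
      rw [this]
      exact h.copy.lt i (hi.trans hj) i' hk (hi.trans_le hi') t ht t' ht'
  obtain ⟨i₁, hi₁, t₁, ht₁, hX⟩ := hlow
  have hXsub := (h.ssubset hj hi₁ ht₁).subset
  have hXF : g i₁ t₁ ∈ F := (h.lower hj).mem i₁ hi₁ t₁ ht₁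
  have hXE : ¬ g i₁ t₁ ⊆ E := fun hs => by
    obtain ⟨t', ht', hn, -⟩ := h.copy.not_subset hj hm h.lt
    have hne : t' ≠ t₀ := fun e => hn (e ▸ subset_rfl)
    have he : g i₁ t₁ = E := by
      by_contra hne
      exact hX (hs.ssubset_of_ne hne)
    exact (hEg t' ht' hne).1
      (he ▸ (h.copy.lt i₁ (hi₁.trans hj) j hj hi₁ t₁ ht₁ t' ht').subset)
  have hXN : ¬ Disjoint (g i₁ t₁) N := fun hd => hXE fun v hv =>
    (Finset.mem_union.1 (hXsub hv)).resolve_right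
      (Finset.disjoint_left.1 (hPN.disj_pos _ hXF hd) hv)
  classical
  let S : Finset α := E.filter fun v => v ∉ P ∧ ∃ i < j, ∃ t < m i, v ∈ g i t
  have hSE : S ⊆ E := Finset.filter_subset _ _
  have hS : ∀ i < j, ∀ t < m i, ∀ v ∈ g i t, v ∉ P → v ∈ S := fun i hi t ht v hv hvP =>
    Finset.mem_filter.2 ⟨(Finset.mem_union.1 ((h.ssubset hj hi ht).subset hv)).resolve_right hvP,
      hvP, i, hi, t, ht, hv⟩
  have hSF : S ∉ F := fun hF => hXN <| Finset.disjoint_left.2 fun v hv hvN =>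
    Finset.disjoint_left.1 (hPN.disj_neg S hF (Finset.disjoint_left.2 fun w hw =>
      (Finset.mem_filter.1 hw).2.1)) (hS i₁ hi₁ t₁ ht₁ v hv
        (Finset.disjoint_right.1 hPN.disj hvN)) hvN
  rcases hasAbove_or_hasBelow_or_copyThrough hfree hsat hj hSF with h' | h' | ⟨g', t', h'⟩
  · refine HasBelow.not_hasAbove hfree hj hm ⟨g, h.lower hj, fun i hi t ht v hv => ?_⟩
      (hPN.hasAbove_union hfree hsat hj hm h')
    by_cases hvP : v ∈ P
    · simp [hvP]
    · simp [hS i hi t ht v hv hvP]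
  · exact hEb (h'.mono hSE)
  · refine hfree _ ((h'.lower hj).glue hcopy fun i hi i' hi' hk t ht s hs => ?_)
    refine (h'.ssubset hj hi ht).trans_subset ?_
    by_cases hc' : i' = j ∧ s = t₀
    · rw [hc'.1, hc'.2, hg₂E]
      exact hSE
    · have : g₂ i' s = g i' s := if_neg hc'
      rw [this]
      intro v hv
      obtain ⟨i₂, hi₂, t₂, ht₂, hv₂⟩ := (Finset.mem_filter.1 hv).2.2
      exact (h.copy.lt i₂ (hi₂.trans hj) i' hk (hi₂.trans_le hi') t₂ ht₂ s hs).subset hv₂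

end Saturated

theorem exists_signPair {α : Type*} [Fintype α] [DecidableEq α] (F : Finset (Finset α))
    (h : F.card + 1 < Fintype.card α) :
    ∃ P N : Finset α, SignPair (F : Set (Finset α)) P N := by
  let L : (α → ℚ) →ₗ[ℚ] (Option F → ℚ) := LinearMap.pi fun o =>
    ∑ i ∈ o.elim Finset.univ Subtype.val, LinearMap.proj i
  have hL : ∀ x o, L x o = ∑ i ∈ o.elim Finset.univ Subtype.val, x i := fun x o => by
    simp [L]
  obtain ⟨x, hx, hx0⟩ := (Submodule.ne_bot_iff _).1
    (LinearMap.ker_ne_bot_of_finrank_lt (f := L) (by simpa using h))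
  have hx' : ∀ o, L x o = 0 := fun o => by rw [LinearMap.mem_ker.1 hx]; rfl
  have huniv : ∑ i, x i = 0 := by
    have := hx' none
    rwa [hL] at this
  have hF : ∀ C ∈ F, ∑ i ∈ C, x i = 0 := fun C hC => by
    have := hx' (some ⟨C, hC⟩)
    rwa [hL] at this
  have hFc : ∀ C ∈ F, ∑ i ∈ Cᶜ, x i = 0 := fun C hC => by
    have := Finset.sum_add_sum_compl C x
    rw [hF C hC, huniv] at this
    linarith
  have hpos : ∀ C : Finset α, ∑ i ∈ C, x i = 0 → (∀ i ∈ C, 0 ≤ x i) → ∀ i ∈ C, ¬ 0 < x i :=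
    fun C hC hn i hi h => h.ne' ((Finset.sum_eq_zero_iff_of_nonneg hn).1 hC i hi)
  have hneg : ∀ C : Finset α, ∑ i ∈ C, x i = 0 → (∀ i ∈ C, x i ≤ 0) → ∀ i ∈ C, ¬ x i < 0 :=
    fun C hC hn i hi h => h.ne ((Finset.sum_eq_zero_iff_of_nonpos hn).1 hC i hi)
  obtain ⟨v, hv⟩ := Function.ne_iff.1 hx0
  refine ⟨Finset.univ.filter fun i => 0 < x i, Finset.univ.filter fun i => x i < 0, ?_⟩
  constructor
  · exact Finset.disjoint_filter.2 fun i _ h => not_lt.2 h.le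
  · by_contra hc
    have hle : ∀ i, x i ≤ 0 := fun i => not_lt.1 fun hi => hc ⟨i, by simpa using hi⟩
    exact hneg _ huniv (fun i _ => hle i) v (Finset.mem_univ v) (lt_of_le_of_ne (hle v) hv)
  · by_contra hc
    have hle : ∀ i, 0 ≤ x i := fun i => not_lt.1 fun hi => hc ⟨i, by simpa using hi⟩
    exact hpos _ huniv (fun i _ => hle i) v (Finset.mem_univ v) (lt_of_le_of_ne (hle v) hv.symm)
  · intro C hC hd
    refine Finset.disjoint_left.2 fun i hi hp => hpos C (hF C hC) (fun l hl => ?_) i hi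
      (Finset.mem_filter.1 hp).2
    simpa using Finset.disjoint_left.1 hd hl
  · intro C hC hd
    refine Finset.disjoint_left.2 fun i hi hp => hneg C (hF C hC) (fun l hl => ?_) i hi
      (Finset.mem_filter.1 hp).2
    simpa using Finset.disjoint_left.1 hd hl
  · intro C hC hs i hi
    by_contra hiC
    refine hneg _ (hFc C hC) (fun l hl => ?_) i (by simpa using hiC) (Finset.mem_filter.1 hi).2
    by_contra hlt
    exact Finset.mem_compl.1 hl (hs (by simpa using hlt))
  · intro C hC hs i hi
    by_contra hiC
    refine hpos _ (hFc C hC) (fun l hl => ?_) i (by simpa using hiC) (Finset.mem_filter.1 hi).2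
    by_contra hlt
    exact Finset.mem_compl.1 hl (hs (by simpa using hlt))
  · intro E hE hEP i hi
    by_contra hiE
    have hsum := Finset.sum_sdiff (f := x) (Finset.subset_union_left (s₁ := E)
      (s₂ := Finset.univ.filter fun i => 0 < x i))
    rw [hF _ hEP, hF E hE, add_zero] at hsum
    refine hpos _ hsum (fun l hl => ?_) i ?_ (Finset.mem_filter.1 hi).2
    · simp only [Finset.mem_sdiff, Finset.mem_union, Finset.mem_filter] at hl
      exact (hl.1.resolve_left hl.2).2.le
    · exact Finset.mem_sdiff.2 ⟨Finset.mem_union_right _ hi, hiE⟩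

/-- A saturated family for a complete multipartite poset with a layer of size at least two has
at least `n - 1` members. -/
theorem le_card_of_saturated {α : Type*} [Fintype α] [DecidableEq α] {m : ℕ → ℕ} {j k : ℕ}
    {F : Finset (Finset α)} (hfree : ∀ g, ¬ LayeredCopy m (Set.Iio k) (F : Set (Finset α)) g)
    (hsat : ∀ S ∉ F, ∃ g, LayeredCopy m (Set.Iio k) (insert S (F : Set (Finset α))) g)
    (hj : j < k) (hm : 2 ≤ m j) : Fintype.card α ≤ F.card + 1 := by
  by_contra! hlt
  obtain ⟨P, N, h⟩ := exists_signPair F hlt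
  exact not_signPair hfree hsat hj hm h

theorem nonempty_of_saturated {α : Type*} {m : ℕ → ℕ} {j k : ℕ} {F : Finset (Finset α)}
    (hsat : ∀ S ∉ F, ∃ g, LayeredCopy m (Set.Iio k) (insert S (F : Set (Finset α))) g)
    (hj : j < k) (hm : 2 ≤ m j) : F.Nonempty := by
  by_contra hF
  rw [Finset.not_nonempty_iff_eq_empty] at hF
  subst hF
  obtain ⟨g, hg⟩ := hsat ∅ (by simp)
  have h0 := hg.mem j hj 0 (by omega)
  have h1 := hg.mem j hj 1 (by omega)
  have := hg.anti j hj 0 (by omega) 1 (by omega) (by simp_all)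
  omega

section Construction

variable {α : Type*} {m : ℕ → ℕ} {k : ℕ} {e : ℕ → α} {Z : Finset α} {s : α}

/-- The data of the construction: a base set `Z`, distinct elements `e 0, …, e k` outside of it
and a further element `s`. -/
structure Frame (m : ℕ → ℕ) (k : ℕ) (e : ℕ → α) (Z : Finset α) (s : α) : Prop where
  pos : ∀ i, 1 ≤ m i
  card : Z.card = (∑ l ∈ Finset.range k, m l) - 2
  notMem : ∀ i ≤ k, e i ∉ Z
  inj : ∀ i ≤ k, ∀ j ≤ k, e i = e j → i = j
  star_notMem : s ∉ Z
  ne_star : ∀ i ≤ k, e i ≠ s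

theorem sum_range_add_sum_range_rev (m : ℕ → ℕ) {i k : ℕ} (hi : i ≤ k) :
    ∑ l ∈ Finset.range i, m l + ∑ l ∈ Finset.range (k - i), m (k - 1 - l) =
      ∑ l ∈ Finset.range k, m l := by
  obtain ⟨d, rfl⟩ := Nat.exists_eq_add_of_le hi
  rw [Nat.add_sub_cancel_left, Finset.sum_range_add,
    ← Finset.sum_range_reflect (fun l => m (i + l))]
  congr 1
  refine Finset.sum_congr rfl fun l hl => congrArg m ?_
  have := Finset.mem_range.1 hl
  omega

theorem Frame.rev (fr : Frame m k e Z s) :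
    Frame (fun l => m (k - 1 - l)) k (fun i => e (k - i)) Z s where
  pos i := fr.pos _
  card := by rw [fr.card, Finset.sum_range_reflect]
  notMem i _ := fr.notMem _ (Nat.sub_le _ _)
  inj i hi j hj h := by
    have := fr.inj _ (Nat.sub_le _ _) _ (Nat.sub_le _ _) h
    omega
  star_notMem := fr.star_notMem
  ne_star i _ := fr.ne_star _ (Nat.sub_le _ _)

theorem Frame.sum_strictMono (fr : Frame m k e Z s) :
    StrictMono fun i => ∑ l ∈ Finset.range i, m l :=
  strictMono_nat_of_lt_succ fun i => by
    have := fr.pos i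
    rw [Finset.sum_range_succ]
    omega

theorem exists_injOn_mem (A : Finset α) (a : α) : ∃ y : ℕ → α, (∀ i < A.card, y i ∈ A) ∧
    ∀ i < A.card, ∀ j < A.card, y i = y j → i = j := by
  refine ⟨fun i => if h : i < A.card then A.equivFin.symm ⟨i, h⟩ else a, fun i hi => ?_,
    fun i hi j hj h => ?_⟩
  · simp [hi]
  · simp only [hi, hj, dite_true] at h
    simpa using A.equivFin.symm.injective (Subtype.ext h)

variable [DecidableEq α] {g : ℕ → ℕ → Finset α}

/-- The low members of the construction: subsets of `Z ∪ {e (i + 1)}` with one more element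
than the total size of the layers below `i`, for `i + 1 < k`. -/
def lowFamily (m : ℕ → ℕ) (k : ℕ) (e : ℕ → α) (Z : Finset α) : Set (Finset α) :=
  {ρ | ∃ i, i + 1 < k ∧ ρ ⊆ insert (e (i + 1)) Z ∧ ρ.card = (∑ l ∈ Finset.range i, m l) + 1}

theorem Frame.card_insert (fr : Frame m k e Z s) (hk : 2 ≤ k) {i : ℕ} (hi : i ≤ k) :
    (insert (e i) Z).card + 1 = ∑ l ∈ Finset.range k, m l := by
  have h := fr.sum_strictMono.le_apply (x := k)
  rw [Finset.card_insert_of_notMem (fr.notMem i hi), fr.card]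
  omega

theorem Frame.star_notMem_low (fr : Frame m k e Z s) {ρ : Finset α}
    (hρ : ρ ∈ lowFamily m k e Z) : s ∉ ρ := by
  obtain ⟨i, hi, hs, -⟩ := hρ
  intro h
  rcases Finset.mem_insert.1 (hs h) with h | h
  · exact fr.ne_star _ hi.le h.symm
  · exact fr.star_notMem h

/-- A member of level `l` lying above copies of the layers below `i` has `i ≤ l`. -/
theorem Frame.le_level (fr : Frame m k e Z s) {i : ℕ}
    (hg : LayeredCopy m (Set.Iio i) (lowFamily m k e Z) g) {ρ : Finset α} {l : ℕ}
    (hρ : ρ.card = (∑ l ∈ Finset.range l, m l) + 1) (hlt : ∀ i' < i, ∀ t < m i', g i' t ⊂ ρ) :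
    i ≤ l := by
  induction i generalizing ρ l with
  | zero => exact Nat.zero_le _
  | succ i ih =>
    obtain ⟨l', hl', -, hc⟩ := hg.mem i (Nat.lt_succ_self i) 0 (fr.pos i)
    have h1 := ih (hg.mono (Set.Iio_subset_Iio (Nat.le_succ i))) hc fun i' hi' t ht =>
      hg.lt i' (Nat.lt_succ_of_lt hi') i (Nat.lt_succ_self i) hi' t ht 0 (fr.pos i)
    have h2 := Finset.card_lt_card (hlt i (Nat.lt_succ_self i) 0 (fr.pos i))
    rw [hc, hρ] at h2
    have h3 := fr.sum_strictMono.lt_iff_lt.1 (Nat.lt_of_add_lt_add_right h2)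
    omega

theorem card_le_card_inter_add_one {ρ Z : Finset α} {x : α} (h : ρ ⊆ insert x Z) :
    ρ.card ≤ (ρ ∩ Z).card + 1 := by
  refine (Finset.card_le_card (t := insert x (ρ ∩ Z)) fun v hv => ?_).trans
    (Finset.card_insert_le _ _)
  rcases Finset.mem_insert.1 (h hv) with h | h
  · exact Finset.mem_insert.2 (Or.inl h)
  · exact Finset.mem_insert_of_mem (Finset.mem_inter.2 ⟨hv, h⟩)

/-- The union of low copies of the layers below `i` is large within `Z ∪ {e i}`. -/
theorem Frame.le_card_inter (fr : Frame m k e Z s) {i : ℕ} (hi : i ≤ k)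
    (hg : LayeredCopy m (Set.Iio i) (lowFamily m k e Z) g) {M : Finset α}
    (hM : ∀ l < i, ∀ t < m l, g l t ⊆ M) :
    ∑ l ∈ Finset.range i, m l ≤ (M ∩ insert (e i) Z).card := by
  induction i generalizing M with
  | zero => simp
  | succ i ih =>
    have hii : i ∈ Set.Iio (i + 1) := Nat.lt_succ_self i
    have hg' := hg.mono (Set.Iio_subset_Iio (Nat.le_succ i))
    have hlt : ∀ i' < i, ∀ t < m i', ∀ t' < m i, g i' t ⊂ g i t' := fun i' hi' t ht t' ht' =>
      hg.lt i' (Nat.lt_succ_of_lt hi') i hii hi' t ht t' ht'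
    let w := (g i 0).filter (fun v => ∀ t < m i, v ∈ g i t) ∩ insert (e i) Z
    have hwg : ∀ t < m i, w ⊆ g i t := fun t ht v hv =>
      (Finset.mem_filter.1 (Finset.mem_inter.1 hv).1).2 t ht
    have hw : ∑ l ∈ Finset.range i, m l ≤ w.card :=
      ih (by omega) hg' fun l hl t ht v hv => Finset.mem_filter.2
        ⟨(hlt l hl t ht 0 (fr.pos i)).subset hv, fun t' ht' => (hlt l hl t ht t' ht').subset hv⟩
    by_cases hlev : ∃ t < m i, ∃ l, i < l ∧ g i t ⊆ insert (e (l + 1)) Z ∧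
        (g i t).card = (∑ l ∈ Finset.range l, m l) + 1
    · obtain ⟨t, ht, l, hil, hs, hc⟩ := hlev
      have h1 := fr.sum_strictMono.monotone (Nat.succ_le_of_lt hil)
      have h2 := card_le_card_inter_add_one hs
      have h3 : (g i t ∩ Z).card ≤ (M ∩ insert (e (i + 1)) Z).card :=
        Finset.card_le_card (Finset.inter_subset_inter (hM i hii t ht) (Finset.subset_insert _ _))
      have h4 : ∑ l ∈ Finset.range (i + 1), m l ≤ ∑ l ∈ Finset.range l, m l := h1
      omega
    · have hall : ∀ t < m i, g i t ⊆ insert (e (i + 1)) Z ∧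
          (g i t).card = (∑ l ∈ Finset.range i, m l) + 1 := fun t ht => by
        obtain ⟨l, -, hs, hc⟩ := hg.mem i hii t ht
        have h1 := fr.le_level hg' hc fun i' hi' t' ht' => hlt i' hi' t' ht' t ht
        rcases h1.eq_or_lt with rfl | h1
        · exact ⟨hs, hc⟩
        · exact (hlev ⟨t, ht, l, h1, hs, hc⟩).elim
      have hsub : ∀ t < m i, g i t ⊆ M ∩ insert (e (i + 1)) Z := fun t ht =>
        Finset.subset_inter (hM i hii t ht) (hall t ht).1
      rw [Finset.sum_range_succ]
      by_cases hwc : ∑ l ∈ Finset.range i, m l < w.card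
      · have heq : ∀ t < m i, w = g i t := fun t ht =>
          Finset.eq_of_subset_of_card_le (hwg t ht) (by rw [(hall t ht).2]; exact hwc)
        have hm1 : m i ≤ 1 := by
          by_contra! h
          have := hg.anti i hii 0 (by omega) 1 h (by rw [← heq 0 (by omega), ← heq 1 h])
          omega
        have := Finset.card_le_card (hsub 0 (fr.pos i))
        rw [(hall 0 (fr.pos i)).2] at this
        omega
      · have : Nonempty α := ⟨s⟩
        have hex : ∀ t < m i, ∃ x, x ∉ w ∧ insert x w = g i t := fun t ht => by
          obtain ⟨x, hx, hxw⟩ := Finset.exists_mem_notMem_of_card_lt_card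
            (s := w) (t := g i t) (by rw [(hall t ht).2]; omega)
          refine ⟨x, hxw, Finset.eq_of_subset_of_card_le
            (Finset.insert_subset hx (hwg t ht)) ?_⟩
          rw [(hall t ht).2, Finset.card_insert_of_notMem hxw]
          omega
        choose! x hxw hx using hex
        have hinj : Set.InjOn x (Finset.range (m i)) := fun t ht t' ht' h => by
          rw [Finset.coe_range, Set.mem_Iio] at ht ht'
          refine hg.anti i hii t ht t' ht' ?_
          rw [← hx t ht, ← hx t' ht', h]
        have hdisj : Disjoint w ((Finset.range (m i)).image x) := by
          rw [Finset.disjoint_right]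
          intro v hv
          obtain ⟨t, ht, rfl⟩ := Finset.mem_image.1 hv
          exact hxw t (Finset.mem_range.1 ht)
        calc ∑ l ∈ Finset.range i, m l + m i
            ≤ w.card + ((Finset.range (m i)).image x).card := by
              rw [Finset.card_image_of_injOn hinj, Finset.card_range]
              omega
          _ = (w ∪ (Finset.range (m i)).image x).card :=
              (Finset.card_union_of_disjoint hdisj).symm
          _ ≤ _ := Finset.card_le_card <| Finset.union_subset
              ((hwg 0 (fr.pos i)).trans (hsub 0 (fr.pos i))) fun v hv => by
                obtain ⟨t, ht, rfl⟩ := Finset.mem_image.1 hv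
                have ht := Finset.mem_range.1 ht
                exact hsub t ht (hx t ht ▸ Finset.mem_insert_self _ _)

/-- A low member above low copies of the layers below `i` that avoids a large subset of
`Z ∪ {e (i + 1)}` has level exactly `i`. -/
theorem Frame.level_eq (fr : Frame m k e Z s) {i : ℕ} (hi : i < k)
    (hg : LayeredCopy m (Set.Iio i) (lowFamily m k e Z) g) {ρ V : Finset α}
    (hρ : ρ ∈ lowFamily m k e Z) (hlt : ∀ i' < i, ∀ t < m i', g i' t ⊂ ρ)
    (hV : Disjoint ρ V) (hcard : ∑ l ∈ Finset.range k, m l ≤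
      ∑ l ∈ Finset.range (i + 1), m l + (V ∩ insert (e (i + 1)) Z).card) :
    ρ ⊆ insert (e (i + 1)) Z ∧ ρ.card = (∑ l ∈ Finset.range i, m l) + 1 := by
  obtain ⟨l, hlk, hs, hc⟩ := hρ
  rcases (fr.le_level hg hc hlt).eq_or_lt with rfl | hil
  · exact ⟨hs, hc⟩
  · exfalso
    have h1 : ∑ l ∈ Finset.range (i + 1), m l ≤ ∑ l ∈ Finset.range l, m l :=
      fr.sum_strictMono.monotone (Nat.succ_le_of_lt hil)
    have h2 := card_le_card_inter_add_one hs
    have h3 : (ρ ∩ Z).card + (V ∩ insert (e (i + 1)) Z).card ≤ (insert (e (i + 1)) Z).card := by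
      rw [← Finset.card_union_of_disjoint (hV.mono Finset.inter_subset_left
        Finset.inter_subset_left)]
      exact Finset.card_le_card (Finset.union_subset
        (Finset.inter_subset_right.trans (Finset.subset_insert _ _)) Finset.inter_subset_right)
    have h4 := fr.card_insert (by omega) (i := i + 1) hi
    omega

/-- If `S` is large within `Z ∪ {e i}` then it has low copies of the layers below `i`. -/
theorem Frame.hasBelow (fr : Frame m k e Z s) {i : ℕ} (hi : i < k) {S : Finset α}
    (hS : ∑ l ∈ Finset.range i, m l ≤ (S ∩ insert (e i) Z).card) :
    HasBelow m (lowFamily m k e Z) i S := by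
  rcases Nat.eq_zero_or_pos i with rfl | hi0
  · exact ⟨fun _ _ => ∅, ⟨by simp, by simp, by simp⟩, by simp⟩
  set q := ∑ l ∈ Finset.range i, m l with hq
  have hq0 : 0 < q := fr.sum_strictMono (a := 0) hi0 |>.trans_le' (by simp)
  obtain ⟨x, hx, hxq⟩ : ∃ x ∈ S ∩ insert (e i) Z, q ≤ ((S ∩ Z).erase x).card + 1 := by
    by_cases hei : e i ∈ S
    · refine ⟨e i, by simp [hei], ?_⟩
      rw [Finset.erase_eq_of_notMem fun h => fr.notMem i hi.le (Finset.mem_inter.1 h).2]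
      rw [Finset.inter_insert_of_mem hei] at hS
      exact hS.trans (Finset.card_insert_le _ _)
    · rw [Finset.inter_insert_of_notMem hei] at hS ⊢
      obtain ⟨x, hx⟩ := Finset.card_pos.1 (hq0.trans_le hS)
      refine ⟨x, hx, ?_⟩
      rw [Finset.card_erase_add_one hx]
      exact hS
  obtain ⟨y₀, hy₀, hinj₀⟩ := exists_injOn_mem ((S ∩ Z).erase x) x
  let y : ℕ → α := fun r => if r + 1 = q then x else y₀ r
  have hyZ : ∀ r, r + 1 < q → y r ∈ (S ∩ Z).erase x := fun r hr => by
    have : y r = y₀ r := if_neg hr.ne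
    rw [this]
    exact hy₀ r (by omega)
  have hylast : ∀ r, r + 1 = q → y r = x := fun r hr => if_pos hr
  have hyS : ∀ r < q, y r ∈ S ∩ insert (e i) Z := fun r hr => by
    rcases (Nat.succ_le_of_lt hr).eq_or_lt with h | h
    · rw [hylast r h]; exact hx
    · have := Finset.mem_inter.1 (Finset.mem_of_mem_erase (hyZ r h))
      exact Finset.mem_inter.2 ⟨this.1, Finset.mem_insert_of_mem this.2⟩
  have hinj : ∀ r < q, ∀ r' < q, y r = y r' → r = r' := fun r hr r' hr' h => by
    rcases (Nat.succ_le_of_lt hr).eq_or_lt with h1 | h1 <;>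
      rcases (Nat.succ_le_of_lt hr').eq_or_lt with h2 | h2
    · omega
    · exact (Finset.ne_of_mem_erase (hyZ r' h2) (h ▸ hylast r h1)).elim
    · exact (Finset.ne_of_mem_erase (hyZ r h1) (h ▸ hylast r' h2)).elim
    · have e1 : y r = y₀ r := if_neg h1.ne
      have e2 : y r' = y₀ r' := if_neg h2.ne
      rw [e1, e2] at h
      exact hinj₀ r (by omega) r' (by omega) h
  let a : ℕ → ℕ := fun l => ∑ l ∈ Finset.range l, m l
  have ha : ∀ l, a (l + 1) = a l + m l := fun l => Finset.sum_range_succ _ _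
  have hamono : ∀ {l l'}, l ≤ l' → a l ≤ a l' := fun h => fr.sum_strictMono.monotone h
  have hai : a i = q := rfl
  let c : ℕ → ℕ → Finset α := fun l t => insert (y (a l + t)) ((Finset.range (a l)).image y)
  have hmem : ∀ l t v, v ∈ c l t ↔ ∃ r, (r = a l + t ∨ r < a l) ∧ y r = v := fun l t v => by
    simp only [c, Finset.mem_insert, Finset.mem_image, Finset.mem_range]
    constructor
    · rintro (rfl | ⟨r, hr, rfl⟩)
      · exact ⟨_, Or.inl rfl, rfl⟩
      · exact ⟨r, Or.inr hr, rfl⟩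
    · rintro ⟨r, rfl | hr, rfl⟩
      · exact Or.inl rfl
      · exact Or.inr ⟨r, hr, rfl⟩
  have hlt : ∀ l < i, ∀ t < m l, a l + t < a (l + 1) ∧ a (l + 1) ≤ q := fun l hl t ht => by
    have h1 := hamono (Nat.succ_le_of_lt hl)
    have h2 := ha l
    have h3 : a (l + 1) ≤ a i := h1
    omega
  have hmemS : ∀ l < i, ∀ t < m l, c l t ⊆ S := fun l hl t ht v hv => by
    obtain ⟨r, hr, rfl⟩ := (hmem l t v).1 hv
    have := hlt l hl t ht
    exact (Finset.mem_inter.1 (hyS r (by omega))).1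
  refine ⟨c, ⟨fun l hl t ht => ?_, fun l hl t ht t' ht' h => ?_,
    fun l hl l' hl' hll t ht t' ht' => ?_⟩, hmemS⟩
  · have h1 := hlt l hl t ht
    refine ⟨l, lt_of_le_of_lt hl hi, fun v hv => ?_, ?_⟩
    · obtain ⟨r, hr, rfl⟩ := (hmem l t v).1 hv
      rcases (Nat.succ_le_of_lt (Set.mem_Iio.1 hl)).eq_or_lt with h2 | h2
      · have := (Finset.mem_inter.1 (hyS r (by omega))).2
        rwa [← h2] at this
      · have h3 : a (l + 1) < q := fr.sum_strictMono h2
        exact Finset.mem_insert_of_mem (Finset.mem_inter.1 (Finset.mem_of_mem_erase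
          (hyZ r (by omega)))).2
    · have hn : y (a l + t) ∉ (Finset.range (a l)).image y := fun hc => by
        obtain ⟨r, hr, he⟩ := Finset.mem_image.1 hc
        have hr := Finset.mem_range.1 hr
        have := hinj r (by omega) (a l + t) (by omega) he
        omega
      rw [Finset.card_insert_of_notMem hn, Finset.card_image_of_injOn, Finset.card_range]
      intro r hr r' hr' he
      rw [Finset.coe_range, Set.mem_Iio] at hr hr'
      exact hinj r (by omega) r' (by omega) he
  · have h1 := hlt l hl t ht
    have h2 := hlt l hl t' ht'
    obtain ⟨r, hr, he⟩ := (hmem l t' _).1 (h ((hmem l t _).2 ⟨a l + t, Or.inl rfl, rfl⟩))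
    have := hinj r (by omega) (a l + t) (by omega) he
    omega
  · have h1 := hlt l hl t ht
    have h2 := hlt l' hl' t' ht'
    have h3 : a (l + 1) ≤ a l' := hamono hll
    refine Finset.ssubset_iff_subset_ne.2 ⟨fun v hv => ?_, fun he => ?_⟩
    · obtain ⟨r, hr, rfl⟩ := (hmem l t v).1 hv
      exact (hmem l' t' _).2 ⟨r, Or.inr (by omega), rfl⟩
    · obtain ⟨r, hr, he⟩ := (hmem l t _).1
        (he ▸ (hmem l' t' _).2 ⟨a l' + t', Or.inl rfl, rfl⟩)
      have := hinj r (by omega) (a l' + t') (by omega) he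
      omega

theorem LayeredCopy.compl [Fintype α] {m₂ : ℕ → ℕ} {I J : Set ℕ} {F : Set (Finset α)}
    (hg : LayeredCopy m I F g) (hJ : ∀ l ∈ J, l < k ∧ k - 1 - l ∈ I ∧ m₂ l = m (k - 1 - l)) :
    LayeredCopy m₂ J {σ | σᶜ ∈ F} (fun l t => (g (k - 1 - l) t)ᶜ) := by
  refine ⟨fun l hl t ht => ?_, fun l hl t ht t' ht' hs => ?_,
    fun l hl l' hl' hll t ht t' ht' => ?_⟩
  · obtain ⟨-, h1, h2⟩ := hJ l hl
    rw [Set.mem_ofPred_eq, compl_compl]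
    exact hg.mem _ h1 t (h2 ▸ ht)
  · obtain ⟨-, h1, h2⟩ := hJ l hl
    exact (hg.anti _ h1 t' (h2 ▸ ht') t (h2 ▸ ht) (Finset.compl_subset_compl.1 hs)).symm
  · obtain ⟨h0, h1, h2⟩ := hJ l hl
    obtain ⟨h0', h1', h2'⟩ := hJ l' hl'
    exact Finset.compl_ssubset_compl.2
      (hg.lt _ h1' _ h1 (by omega) t' (h2' ▸ ht') t (h2 ▸ ht))

/-- The high members of the construction: complements of the low members for the reversed
data. -/
def highFamily [Fintype α] (m : ℕ → ℕ) (k : ℕ) (e : ℕ → α) (Z : Finset α) : Set (Finset α) :=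
  {σ | σᶜ ∈ lowFamily (fun l => m (k - 1 - l)) k (fun i => e (k - i)) Z}

section Fintype

variable [Fintype α]

theorem Frame.star_mem_high (fr : Frame m k e Z s) {σ : Finset α}
    (hσ : σ ∈ highFamily m k e Z) : s ∈ σ := by
  simpa using fr.rev.star_notMem_low hσ

theorem layeredCopy_low_of_high {i : ℕ} (hg : LayeredCopy m (Set.Ico i k) (highFamily m k e Z) g) :
    LayeredCopy (fun l => m (k - 1 - l)) (Set.Iio (k - i))
      (lowFamily (fun l => m (k - 1 - l)) k (fun i => e (k - i)) Z)
      (fun l t => (g (k - 1 - l) t)ᶜ) := by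
  have hJ : ∀ l ∈ Set.Iio (k - i), l < k ∧ k - 1 - l ∈ Set.Ico i k := fun l hl => by
    simp only [Set.mem_Iio, Set.mem_Ico] at hl ⊢
    omega
  exact (hg.compl fun l hl => ⟨(hJ l hl).1, (hJ l hl).2, rfl⟩).of_mem fun l hl t ht =>
    hg.mem _ (hJ l hl).2 t ht

theorem Frame.le_card_inter_high (fr : Frame m k e Z s) {i : ℕ} (hi : i ≤ k)
    (hg : LayeredCopy m (Set.Ico i k) (highFamily m k e Z) g) {V : Finset α}
    (hV : ∀ l, i ≤ l → l < k → ∀ t < m l, (g l t)ᶜ ⊆ V) :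
    ∑ l ∈ Finset.range k, m l ≤
      ∑ l ∈ Finset.range i, m l + (V ∩ insert (e i) Z).card := by
  have h := fr.rev.le_card_inter (Nat.sub_le k i) (layeredCopy_low_of_high hg) (M := V)
    fun l hl t ht => hV _ (by omega) (by omega) t ht
  rw [Nat.sub_sub_self hi] at h
  have := sum_range_add_sum_range_rev m hi
  omega

/-- No layer of a copy inside the construction contains both low and high members. -/
theorem Frame.not_low_and_high (fr : Frame m k e Z s) {i : ℕ} (hi : i < k)
    (hg : LayeredCopy m (Set.Iio k) (lowFamily m k e Z ∪ highFamily m k e Z) g) {t₁ t₂ : ℕ}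
    (ht₁ : t₁ < m i) (ht₂ : t₂ < m i) (h₁ : g i t₁ ∈ lowFamily m k e Z) :
    g i t₂ ∉ highFamily m k e Z := by
  intro h₂
  have hlow : LayeredCopy m (Set.Iio i) (lowFamily m k e Z) g :=
    (hg.mono (Set.Iio_subset_Iio hi.le)).of_mem fun l hl t ht =>
      (hg.mem l (lt_trans hl hi) t ht).resolve_right fun h => fr.star_notMem_low h₁
        ((hg.lt l (lt_trans hl hi) i hi hl t ht t₁ ht₁).subset (fr.star_mem_high h))
  have hhigh : LayeredCopy m (Set.Ico (i + 1) k) (highFamily m k e Z) g :=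
    (hg.mono fun _ hl => hl.2).of_mem fun l hl t ht =>
      (hg.mem l hl.2 t ht).resolve_left fun h => fr.star_notMem_low h
        ((hg.lt i hi l hl.2 hl.1 t₂ ht₂ t ht).subset (fr.star_mem_high h₂))
  classical
  let W : Finset α := Finset.univ.filter fun v => ∃ l < i, ∃ t < m l, v ∈ g l t
  let V : Finset α := Finset.univ.filter fun v => ∃ l, i < l ∧ l < k ∧ ∃ t < m l, v ∉ g l t
  have hWg : ∀ t < m i, W ⊆ g i t := fun t ht v hv => by
    obtain ⟨l, hl, t', ht', hv⟩ := (Finset.mem_filter.1 hv).2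
    exact (hg.lt l (hl.trans hi) i hi hl t' ht' t ht).subset hv
  have hVg : ∀ t < m i, V ⊆ (g i t)ᶜ := fun t ht v hv => by
    obtain ⟨l, hl, hlk, t', ht', hv⟩ := (Finset.mem_filter.1 hv).2
    exact Finset.mem_compl.2 fun h => hv ((hg.lt i hi l hlk hl t ht t' ht').subset h)
  have hW := fr.le_card_inter hi.le hlow (M := W) fun l hl t ht v hv =>
    Finset.mem_filter.2 ⟨Finset.mem_univ _, l, hl, t, ht, hv⟩
  have hV := fr.le_card_inter_high (show i + 1 ≤ k from hi) hhigh (V := V) fun l hl hl' t ht v hv =>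
    Finset.mem_filter.2 ⟨Finset.mem_univ _, l, hl, hl', t, ht, Finset.mem_compl.1 hv⟩
  have hrev := sum_range_add_sum_range_rev m hi.le
  have hrev' := sum_range_add_sum_range_rev m (show i + 1 ≤ k from hi)
  rw [Finset.sum_range_succ] at hrev' hV
  have hlowi : ∀ t < m i, g i t ∈ lowFamily m k e Z → g i t ⊆ insert (e (i + 1)) Z ∧
      (g i t).card = (∑ l ∈ Finset.range i, m l) + 1 := fun t ht h =>
    fr.level_eq hi hlow h (fun l hl t' ht' => hg.lt l (hl.trans hi) i hi hl t' ht' t ht)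
      (V := V) (Finset.disjoint_left.2 fun v hv hvV => Finset.mem_compl.1 (hVg t ht hvV) hv)
      (by rw [Finset.sum_range_succ]; exact hV)
  have hhighi : ∀ t < m i, g i t ∈ highFamily m k e Z → (g i t)ᶜ ⊆ insert (e i) Z ∧
      (g i t)ᶜ.card = (∑ l ∈ Finset.range (k - (i + 1)), m (k - 1 - l)) + 1 := fun t ht h => by
    have hk1 : k - (i + 1) + 1 = k - i := by omega
    have := fr.rev.level_eq (i := k - (i + 1)) (by omega) (layeredCopy_low_of_high hhigh) h
      (fun l hl t' ht' => Finset.compl_ssubset_compl.2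
        (hg.lt i hi (k - 1 - l) (Set.mem_Iio.2 (by omega)) (by omega) t ht t' ht'))
      (V := W) (Finset.disjoint_left.2 fun v hv hvW => Finset.mem_compl.1 hv (hWg t ht hvW)) (by
        rw [hk1, Nat.sub_sub_self hi.le, Finset.sum_range_reflect]
        omega)
    rwa [hk1, Nat.sub_sub_self hi.le] at this
  let w := W ∩ insert (e i) Z
  let v := V ∩ insert (e (i + 1)) Z
  have hpair : ∀ t < m i, ∀ t' < m i, g i t ∈ lowFamily m k e Z → g i t' ∈ highFamily m k e Z →
      ∃ x, x ∉ w ∧ x ∉ v ∧ g i t = insert x w ∧ (g i t')ᶜ = insert x v := by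
    intro t ht t' ht' h h'
    obtain ⟨x, hx, hx'⟩ : ∃ x ∈ g i t, x ∉ g i t' := by
      by_contra! hc
      have := hg.anti i hi t ht t' ht' hc
      exact fr.star_notMem_low h (this ▸ fr.star_mem_high h')
    have hxw : x ∉ w := fun hc => hx' (hWg t' ht' (Finset.mem_inter.1 hc).1)
    have hxv : x ∉ v := fun hc => Finset.mem_compl.1 (hVg t ht (Finset.mem_inter.1 hc).1) hx
    refine ⟨x, hxw, hxv, ?_, ?_⟩
    · refine (Finset.eq_of_subset_of_card_le (Finset.insert_subset hx
        (Finset.inter_subset_left.trans (hWg t ht))) ?_).symm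
      rw [(hlowi t ht h).2, Finset.card_insert_of_notMem hxw]
      exact Nat.succ_le_succ hW
    · refine (Finset.eq_of_subset_of_card_le (Finset.insert_subset (Finset.mem_compl.2 hx')
        (Finset.inter_subset_left.trans (hVg t' ht'))) ?_).symm
      rw [(hhighi t' ht' h').2, Finset.card_insert_of_notMem hxv]
      have : v.card = (V ∩ insert (e (i + 1)) Z).card := rfl
      omega
  obtain ⟨x, hxw, hxv, hρ, hη⟩ := hpair t₁ ht₁ t₂ ht₂ h₁ h₂
  have hd : Disjoint w v := Finset.disjoint_left.2 fun u hu hu' =>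
    Finset.mem_compl.1 (hVg t₁ ht₁ (Finset.mem_inter.1 hu').1) (hWg t₁ ht₁ (Finset.mem_inter.1 hu).1)
  have hZ : ∀ u, u ∈ insert (e i) Z → u ∈ insert (e (i + 1)) Z → u ∈ Z := fun u hu hu' => by
    rcases Finset.mem_insert.1 hu with rfl | hu
    · rcases Finset.mem_insert.1 hu' with h | h
      · have := fr.inj _ hi.le _ hi h
        omega
      · exact h
    · exact hu
  have hsub : insert x (w ∪ v) ⊆ Z := by
    have h1 := (hlowi t₁ ht₁ h₁).1
    have h2 := (hhighi t₂ ht₂ h₂).1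
    rw [hρ, Finset.insert_subset_iff] at h1
    rw [hη, Finset.insert_subset_iff] at h2
    exact Finset.insert_subset (hZ x h2.1 h1.1) (Finset.union_subset
      (fun u hu => hZ u (Finset.mem_inter.1 hu).2 (h1.2 hu))
      fun u hu => hZ u (h2.2 hu) (Finset.mem_inter.1 hu).2)
  have hcard := Finset.card_le_card hsub
  rw [Finset.card_insert_of_notMem (by simp [hxw, hxv]), Finset.card_union_of_disjoint hd,
    fr.card] at hcard
  have hwc : ∑ l ∈ Finset.range i, m l ≤ w.card := hW
  have hvc : v.card = (V ∩ insert (e (i + 1)) Z).card := rfl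
  obtain ⟨t₃, ht₃, hne₁, hne₂⟩ : ∃ t < m i, t ≠ t₁ ∧ t ≠ t₂ := by
    by_contra! hc
    have c0 := hc 0 (by omega)
    have c1 := hc 1 (by omega)
    have c2 := hc 2 (by omega)
    omega
  rcases hg.mem i hi t₃ ht₃ with h₃ | h₃
  · obtain ⟨y, -, hyv, hρ', hη'⟩ := hpair t₃ ht₃ t₂ ht₂ h₃ h₂
    have hyx : y = x := by
      have : y ∈ insert x v := by rw [← hη, hη']; exact Finset.mem_insert_self _ _
      exact (Finset.mem_insert.1 this).resolve_right hyv
    exact hne₁ (hg.anti i hi _ ht₃ _ ht₁ (by rw [hρ', hρ, hyx]))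
  · obtain ⟨y, hyw, -, hρ', hη'⟩ := hpair t₁ ht₁ t₃ ht₃ h₁ h₃
    have hyx : y = x := by
      have : y ∈ insert x w := by rw [← hρ, hρ']; exact Finset.mem_insert_self _ _
      exact (Finset.mem_insert.1 this).resolve_right hyw
    refine hne₂ (hg.anti i hi _ ht₃ _ ht₂ ?_)
    rw [← compl_compl (g i t₃), hη', hyx, ← hη, compl_compl]

theorem Frame.not_layeredCopy (fr : Frame m k e Z s) (hk : 1 ≤ k) :
    ¬ LayeredCopy m (Set.Iio k) (lowFamily m k e Z ∪ highFamily m k e Z) g := by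
  intro hg
  have hk2 : 2 ≤ k := by
    rcases hg.mem 0 hk 0 (fr.pos 0) with ⟨l, hl, -⟩ | ⟨l, hl, -⟩ <;> omega
  have hex : ∃ i, i = k ∨ ∃ t < m i, g i t ∈ highFamily m k e Z := ⟨k, Or.inl rfl⟩
  classical
  let i := Nat.find hex
  have hik : i ≤ k := Nat.find_min' hex (Or.inl rfl)
  have hlow : LayeredCopy m (Set.Iio i) (lowFamily m k e Z) g :=
    (hg.mono (Set.Iio_subset_Iio hik)).of_mem fun l hl t ht =>
      (hg.mem l (lt_of_lt_of_le hl hik) t ht).resolve_right fun h =>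
        Nat.find_min hex hl (Or.inr ⟨t, ht, h⟩)
  have hhigh : LayeredCopy m (Set.Ico i k) (highFamily m k e Z) g :=
    (hg.mono fun _ hl => hl.2).of_mem fun l hl t ht => by
      refine (hg.mem l hl.2 t ht).resolve_left fun h => ?_
      obtain ⟨t', ht', h'⟩ := (Nat.find_spec hex).resolve_left (lt_of_le_of_lt hl.1 hl.2).ne
      rcases hl.1.eq_or_lt with he | hlt
      · rw [← he] at h ht
        exact fr.not_low_and_high (lt_of_le_of_lt hl.1 hl.2) hg ht ht' h h'
      · exact fr.star_notMem_low h ((hg.lt i (lt_of_le_of_lt hl.1 hl.2) l hl.2 hlt t' ht' t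
          ht).subset (fr.star_mem_high h'))
  let W : Finset α := Finset.univ.filter fun v => ∃ l < i, ∃ t < m l, v ∈ g l t
  have h1 := fr.le_card_inter hik hlow (M := W) fun l hl t ht v hv =>
    Finset.mem_filter.2 ⟨Finset.mem_univ _, l, hl, t, ht, hv⟩
  have h2 := fr.le_card_inter_high hik hhigh (V := Wᶜ) fun l hl hl' t ht =>
    Finset.compl_subset_compl.2 fun v hv => by
      obtain ⟨l', hl'', t', ht', hv⟩ := (Finset.mem_filter.1 hv).2
      exact (hg.lt l' (hl''.trans_le hik) l hl' (hl''.trans_le hl) t' ht' t ht).subset hv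
  have h3 := fr.card_insert hk2 hik
  have hd : Disjoint W Wᶜ := disjoint_compl_right
  have h4 : (W ∩ insert (e i) Z).card + (Wᶜ ∩ insert (e i) Z).card = (insert (e i) Z).card := by
    rw [← Finset.card_union_of_disjoint (hd.mono
      Finset.inter_subset_left Finset.inter_subset_left), ← Finset.union_inter_distrib_right]
    simp
  omega

theorem Frame.hasAbove (fr : Frame m k e Z s) {j : ℕ} (hj : j < k) {S : Finset α}
    (hS : ∑ l ∈ Finset.range k, m l ≤
      ∑ l ∈ Finset.range (j + 1), m l + (S ∩ insert (e (j + 1)) Z).card) :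
    HasAbove m (highFamily m k e Z) (j + 1) k Sᶜ := by
  have hrev := sum_range_add_sum_range_rev m (show j + 1 ≤ k from hj)
  obtain ⟨g, hg, hgS⟩ := fr.rev.hasBelow (i := k - (j + 1)) (by omega) (S := S) (by
    rw [Nat.sub_sub_self (show j + 1 ≤ k from hj)]
    omega)
  have hidx : ∀ l, j + 1 ≤ l → l < k → k - 1 - l < k - (j + 1) ∧ m l = m (k - 1 - (k - 1 - l)) :=
    fun l h1 h2 => ⟨by omega, congrArg m (by omega)⟩
  refine ⟨_, hg.compl (k := k) (m₂ := m) (J := Set.Ico (j + 1) k)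
    fun l hl => ⟨hl.2, hidx l hl.1 hl.2⟩, fun l hl hl' t ht => ?_⟩
  exact Finset.compl_subset_compl.2 (hgS _ (hidx l hl hl').1 t (ht.trans_eq (hidx l hl hl').2))

/-- In a family without copies that extends the construction, few members share both their
trace on the finite set carrying the construction and their size. -/
theorem Frame.card_fiber_le (fr : Frame m k e Z s) (hk : 1 ≤ k) {F : Finset (Finset α)}
    (hlow : lowFamily m k e Z ⊆ F) (hhigh : highFamily m k e Z ⊆ F)
    (hfree : ∀ g, ¬ LayeredCopy m (Set.Iio k) (F : Set (Finset α)) g) {R : Finset α}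
    (hR : ∀ i ≤ k, insert (e i) Z ⊆ R) (T : Finset α) (c : ℕ) :
    (F.filter fun S => (S ∩ R, S.card) = (T, c)).card ≤ ∑ l ∈ Finset.range k, m l := by
  set A := F.filter fun S => (S ∩ R, S.card) = (T, c) with hA
  by_contra! hlt
  have hAF : ∀ S ∈ A, S ∈ F ∧ T ⊆ S ∧ S ⊆ (R \ T)ᶜ ∧ S.card = c := fun S hS => by
    obtain ⟨h1, h2⟩ := Finset.mem_filter.1 hS
    obtain ⟨h3, h4⟩ := Prod.mk.inj h2
    refine ⟨h1, h3 ▸ Finset.inter_subset_left, fun v hv => ?_, h4⟩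
    rw [← h3]
    simp only [Finset.mem_compl, Finset.mem_sdiff, Finset.mem_inter]
    tauto
  obtain ⟨j, hj, hbelow, habove⟩ : ∃ j < k, HasBelow m (lowFamily m k e Z) j T ∧
      HasAbove m (highFamily m k e Z) (j + 1) k (R \ T)ᶜ := by
    let Q : ℕ → Prop := fun j => ∑ l ∈ Finset.range j, m l ≤ (T ∩ insert (e j) Z).card
    classical
    let j := Nat.findGreatest Q (k - 1)
    have hjk : j ≤ k - 1 := Nat.findGreatest_le _
    have hQ : Q j := Nat.findGreatest_spec (Nat.zero_le _) (by simp [Q])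
    refine ⟨j, by omega, fr.hasBelow (by omega) hQ, fr.hasAbove (by omega) ?_⟩
    rcases hjk.eq_or_lt with he | hlt
    · have : j + 1 = k := by omega
      rw [this]
      exact Nat.le_add_right _ _
    · have hnQ : ¬ Q (j + 1) := Nat.findGreatest_is_greatest (Nat.lt_succ_self j) hlt
      have h1 := not_le.1 hnQ
      have h2 := fr.card_insert (by omega) (i := j + 1) (by omega)
      have h3 : insert (e (j + 1)) Z ⊆ T ∩ insert (e (j + 1)) Z ∪ (R \ T) ∩ insert (e (j + 1)) Z :=
        fun v hv => by
          have := hR (j + 1) (by omega) hv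
          simp only [Finset.mem_union, Finset.mem_inter, Finset.mem_sdiff]
          tauto
      have h4 := (Finset.card_le_card h3).trans (Finset.card_union_le _ _)
      omega
  obtain ⟨g₁, hg₁, hT₁⟩ := hbelow
  obtain ⟨g₂, hg₂, hT₂⟩ := habove
  obtain ⟨y, hyA, hyinj⟩ := exists_injOn_mem A ∅
  have hmj : m j ≤ ∑ l ∈ Finset.range k, m l :=
    Finset.single_le_sum (fun _ _ => Nat.zero_le _) (Finset.mem_range.2 hj)
  have hne : ∀ S ∈ A, ∃ S' ∈ A, S' ≠ S := fun S _ =>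
    Finset.exists_mem_ne (by have := fr.pos j; omega) S
  have heq : ∀ S ∈ A, ∀ S' ∈ A, S ⊆ S' → S = S' := fun S hS S' hS' h =>
    Finset.eq_of_subset_of_card_le h (by rw [(hAF S hS).2.2.2, (hAF S' hS').2.2.2])
  have hbot : ∀ i < j, ∀ t < m i, ∀ S ∈ A, g₁ i t ⊂ S := fun i hi t ht S hS => by
    refine ((hT₁ i hi t ht).trans (hAF S hS).2.1).ssubset_of_ne fun h => ?_
    obtain ⟨S', hS', hn⟩ := hne S hS
    exact hn (heq S hS S' hS' (h ▸ (hT₁ i hi t ht).trans (hAF S' hS').2.1)).symm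
  have htop : ∀ i, j + 1 ≤ i → i < k → ∀ t < m i, ∀ S ∈ A, S ⊂ g₂ i t :=
    fun i hi hi' t ht S hS => by
      refine ((hAF S hS).2.2.1.trans (hT₂ i hi hi' t ht)).ssubset_of_ne fun h => ?_
      obtain ⟨S', hS', hn⟩ := hne S hS
      exact hn (heq S' hS' S hS (h ▸ (hAF S' hS').2.2.1.trans (hT₂ i hi hi' t ht)))
  have hmid : LayeredCopy m (Set.Ico j (j + 1)) (F : Set (Finset α)) (fun _ t => y t) := by
    have hIco : ∀ i ∈ Set.Ico j (j + 1), i = j := fun i hi => by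
      simp only [Set.mem_Ico] at hi
      omega
    refine ⟨fun i hi t ht => ?_, fun i hi t ht t' ht' h => ?_, fun i hi i' hi' hl => ?_⟩
    · rw [hIco i hi] at ht
      exact (hAF _ (hyA t (by omega))).1
    · rw [hIco i hi] at ht ht'
      exact hyinj t (by omega) t' (by omega) (heq _ (hyA t (by omega)) _ (hyA t' (by omega)) h)
    · rw [hIco i hi, hIco i' hi'] at hl
      omega
  have hbm := (hg₁.of_mem fun i hi t ht => hlow (hg₁.mem i hi t ht)).glue hmid
    fun i hi i' hi' hi'' t ht t' ht' => by
      obtain rfl : i' = j := by omega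
      exact hbot i hi t ht _ (hyA t' (by omega))
  refine hfree _ (hbm.glue (hg₂.of_mem fun i hi t ht => hhigh (hg₂.mem i hi t ht))
    fun i hi i' hi' hi'' t ht t' ht' => ?_)
  by_cases hij : i < j
  · simp only [hij, if_true]
    exact (hbot i hij t ht _ (hyA 0 (by omega))).trans (htop i' hi' hi'' t' ht' _ (hyA 0 (by omega)))
  · obtain rfl : i = j := by omega
    simp only [lt_irrefl, if_false]
    exact htop i' hi' hi'' t' ht' _ (hyA t (by omega))

end Fintype

end Construction

theorem exists_frame {m : ℕ → ℕ} (hm : ∀ i, 1 ≤ m i) {k n : ℕ}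
    (hn : ∑ l ∈ Finset.range k, m l + k + 2 ≤ n) :
    ∃ (e : ℕ → Fin n) (Z : Finset (Fin n)) (s : Fin n), Frame m k e Z s := by
  set q := ∑ l ∈ Finset.range k, m l - 2 with hq
  have hqn : q + k + 2 ≤ n := by omega
  refine ⟨fun i => ⟨min (q + i) (n - 1), by omega⟩, Finset.univ.filter fun v => v.val < q,
    ⟨n - 1, by omega⟩, hm, ?_, fun i hi => ?_, fun i hi j hj h => ?_, ?_, fun i hi h => ?_⟩
  · rw [Fin.card_filter_val_lt]
    omega
  · simp only [Finset.mem_filter, Finset.mem_univ, true_and]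
    omega
  · have := Fin.mk.inj h
    omega
  · simp only [Finset.mem_filter, Finset.mem_univ, true_and]
    omega
  · have := Fin.mk.inj h
    omega

theorem satStar_le_of_le {k : ℕ} {sz : Fin k → ℕ} {m : ℕ → ℕ} (hm : ∀ i : Fin k, m i = sz i)
    (hpos : ∀ i, 1 ≤ m i) (hk : 1 ≤ k) {n : ℕ} (hn : ∑ l ∈ Finset.range k, m l + k + 2 ≤ n) :
    satStar n (MPoset k sz fun _ => false) ≤
      (∑ l ∈ Finset.range k, m l) * (2 ^ (∑ l ∈ Finset.range k, m l + k + 1) * (n + 1)) := by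
  classical
  obtain ⟨e, Z, s, fr⟩ := exists_frame hpos hn
  let F₀ := (lowFamily m k e Z ∪ highFamily m k e Z).toFinset
  have hF₀ : (F₀ : Set (Finset (Fin n))) = lowFamily m k e Z ∪ highFamily m k e Z :=
    Set.coe_toFinset _
  obtain ⟨F, hsub, hF⟩ := exists_isSaturated_superset (P := MPoset k sz fun _ => false) F₀
    (by
      rw [hF₀, containsCopy_iff hm]
      rintro ⟨g, hg⟩
      exact fr.not_layeredCopy hk hg)
  have hsub' : lowFamily m k e Z ∪ highFamily m k e Z ⊆ F := hF₀ ▸ Finset.coe_subset.2 hsub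
  let R := Z ∪ (Finset.range (k + 1)).image e
  have hRcard : R.card ≤ ∑ l ∈ Finset.range k, m l + k + 1 := by
    have h1 : R.card ≤ Z.card + ((Finset.range (k + 1)).image e).card := Finset.card_union_le _ _
    have h2 := Finset.card_image_le (s := Finset.range (k + 1)) (f := e)
    rw [Finset.card_range] at h2
    have h3 := fr.card
    omega
  have hR : ∀ i ≤ k, insert (e i) Z ⊆ R := fun i hi =>
    Finset.insert_subset (Finset.mem_union_right _ (Finset.mem_image_of_mem e
      (Finset.mem_range.2 (Nat.lt_succ_of_le hi)))) Finset.subset_union_left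
  have himage : F.image (fun S => (S ∩ R, S.card)) ⊆ R.powerset ×ˢ Finset.range (n + 1) := by
    intro p hp
    obtain ⟨S, -, rfl⟩ := Finset.mem_image.1 hp
    refine Finset.mem_product.2 ⟨Finset.mem_powerset.2 Finset.inter_subset_right,
      Finset.mem_range.2 (Nat.lt_succ_of_le ?_)⟩
    simpa using Finset.card_le_univ S
  calc satStar n (MPoset k sz fun _ => false) ≤ F.card := satStar_le hF
    _ ≤ (∑ l ∈ Finset.range k, m l) * (F.image fun S => (S ∩ R, S.card)).card :=
      Finset.card_le_mul_card_image F _ fun p _ =>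
        fr.card_fiber_le hk (Set.subset_union_left.trans hsub')
          (Set.subset_union_right.trans hsub')
          (fun g hg => hF.1 ((containsCopy_iff hm _).2 ⟨g, hg⟩)) hR p.1 p.2
    _ ≤ (∑ l ∈ Finset.range k, m l) * (2 ^ R.card * (n + 1)) := by
      refine Nat.mul_le_mul_left _ ((Finset.card_le_card himage).trans_eq ?_)
      rw [Finset.card_product, Finset.card_powerset, Finset.card_range]
    _ ≤ _ := Nat.mul_le_mul_left _ (Nat.mul_le_mul_right _
      (Nat.pow_le_pow_right two_pos hRcard))

theorem satStar_eq_zero (n : ℕ) (P : Type) [PartialOrder P] [IsEmpty P] : satStar n P = 0 := by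
  refine Nat.sInf_eq_zero.2 (Or.inr (Set.eq_empty_of_forall_notMem ?_))
  rintro _ ⟨F, hF, -⟩
  exact hF.1 ⟨isEmptyElim, fun a => isEmptyElim a, isEmptyElim, isEmptyElim⟩

theorem satStar_le_two_pow (n : ℕ) (P : Type) [PartialOrder P] : satStar n P ≤ 2 ^ n := by
  rcases isEmpty_or_nonempty P with _ | _
  · exact (satStar_eq_zero n P).trans_le (Nat.zero_le _)
  · obtain ⟨F, -, hF⟩ := exists_isSaturated_card_eq (P := P) n
    rw [← hF]
    simpa using Finset.card_le_univ F

/-- the complete multipartite poset `K_{n₁,…,n_k}` (here `MPoset` with all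
components antichains, `sz i` being the size of layer `i`, layer `0` at the bottom) has
induced saturation number `O(n)`; and if some layer has size at least `2`, it is also at
least `(n+1)/9`, hence `Θ(n)`. -/
theorem statement18 (k : ℕ) (sz : Fin k → ℕ) (hsz : ∀ i, 1 ≤ sz i) :
    (∃ C : ℕ, ∀ n : ℕ, 1 ≤ n →
      satStar n (MPoset k sz (fun _ => false)) ≤ C * n) ∧
    ((∃ i, 2 ≤ sz i) → ∀ n : ℕ, 1 ≤ n →
      ((n : ℝ) + 1) / 9 ≤ (satStar n (MPoset k sz (fun _ => false)) : ℝ)) := by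
  let m : ℕ → ℕ := fun i => if h : i < k then sz ⟨i, h⟩ else 1
  have hm : ∀ i : Fin k, m i = sz i := fun i => dif_pos i.2
  have hpos : ∀ i, 1 ≤ m i := fun i => by
    by_cases h : i < k
    · simpa [m, h] using hsz ⟨i, h⟩
    · simp [m, h]
  constructor
  · set N := ∑ l ∈ Finset.range k, m l with hN
    refine ⟨2 ^ (N + k + 2) + N * (2 ^ (N + k + 1) * 2), fun n hn => ?_⟩
    by_cases hkn : 1 ≤ k ∧ N + k + 2 ≤ n
    · refine (satStar_le_of_le hm hpos hkn.1 hkn.2).trans ?_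
      calc N * (2 ^ (N + k + 1) * (n + 1)) ≤ N * (2 ^ (N + k + 1) * (2 * n)) := by
            gcongr
            omega
        _ = N * (2 ^ (N + k + 1) * 2) * n := by ring
        _ ≤ _ := Nat.mul_le_mul_right _ (Nat.le_add_left _ _)
    · rcases Nat.eq_zero_or_pos k with rfl | hk
      · have : IsEmpty (MPoset 0 sz fun _ => false) := ⟨fun p => p.1.1.elim0⟩
        simp [satStar_eq_zero]
      · calc satStar n (MPoset k sz fun _ => false) ≤ 2 ^ n := satStar_le_two_pow _ _
          _ ≤ 2 ^ (N + k + 2) := Nat.pow_le_pow_right two_pos (by omega)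
          _ ≤ 2 ^ (N + k + 2) + N * (2 ^ (N + k + 1) * 2) := Nat.le_add_right _ _
          _ ≤ _ := Nat.le_mul_of_pos_right _ hn
  · rintro ⟨j, hj⟩ n -
    have : Nonempty (MPoset k sz fun _ => false) := ⟨⟨(j, 0), hsz j⟩⟩
    obtain ⟨F, hF, hcard⟩ := exists_isSaturated_card_eq (P := MPoset k sz fun _ => false) n
    have hj' : 2 ≤ m j := (hm j).symm ▸ hj
    have hsat := fun S hS => (containsCopy_iff hm _).1 (hF.2 S hS)
    have h1 := le_card_of_saturated (m := m)
      (fun g hg => hF.1 ((containsCopy_iff hm _).2 ⟨g, hg⟩)) hsat j.2 hj'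
    have h2 := (nonempty_of_saturated hsat j.2 hj').card_pos
    rw [Fintype.card_fin, hcard] at h1
    rw [hcard] at h2
    have h3 : ((n + 1 : ℕ) : ℝ) ≤ ((9 * satStar n (MPoset k sz fun _ => false) : ℕ) : ℝ) :=
      Nat.cast_le.2 (by omega)
    push_cast at h3
    linarith
end
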